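/- arXiv:2305.08402 — 10 statements merged into one kernel-verified Lean document; each statement's English description precedes it below -/
import Mathlib

section
/- Let p be a nonzero integer. For every irreducible representation φ : Γ_p → SL₂(ℂ), the matrix φ(𝔪) is diagonalizable: there exist an invertible 2×2 complex matrix P and a ∈ ℂ× such that P · φ(𝔪) · P⁻¹ is the diagonal matrix diag(a, a⁻¹). -/
open Matrix

/-- `SL₂(ℂ)`. -/
abbrev SL2 : Type := Matrix.SpecialLinearGroup (Fin 2) ℂ

/-- The relators of the presentation of `π₁(S³_{p/1}(4₁))`:
generators `x₁ = of 0`, `x₂ = of 1`, `𝔪 = of 2`. -/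
def figRels (p : ℤ) : Set (FreeGroup (Fin 3)) :=
  { FreeGroup.of 2 * FreeGroup.of 0 * FreeGroup.of 1 * (FreeGroup.of 2)⁻¹ * (FreeGroup.of 0)⁻¹,
    FreeGroup.of 2 * FreeGroup.of 1 * FreeGroup.of 0 * FreeGroup.of 1 * (FreeGroup.of 2)⁻¹ *
      (FreeGroup.of 1)⁻¹,
    FreeGroup.of 0 * FreeGroup.of 1 * (FreeGroup.of 0)⁻¹ * (FreeGroup.of 1)⁻¹ *
      (FreeGroup.of 2) ^ p }

/-- The group `Γ_p = π₁(S³_{p/1}(4₁))`. -/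
abbrev Gamma (p : ℤ) : Type := PresentedGroup (figRels p)

/-- The generator `𝔪`. -/
def mGen (p : ℤ) : Gamma p := PresentedGroup.of 2

/-- A representation is irreducible if no 1-dimensional subspace (i.e. no line spanned by a
nonzero vector) is invariant under all `φ g`. -/
def IsIrrRep {p : ℤ} (φ : Gamma p →* SL2) : Prop :=
  ¬ ∃ v : Fin 2 → ℂ, v ≠ 0 ∧ ∀ g : Gamma p, ∃ c : ℂ,
      Matrix.mulVec ((φ g : Matrix (Fin 2) (Fin 2) ℂ)) v = c • v

/-- Every element of `SL₂(ℂ)` is conjugate, inside `SL₂(ℂ)`, to an upper triangular matrix. -/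
theorem SL2.exists_conj_upperTriangular (A : SL2) :
    ∃ P : SL2, (P * A * P⁻¹).1 1 0 = 0 := by
  by_cases hb : A.1 0 1 = 0
  · obtain ⟨P, hP⟩ : ∃ P : SL2, P.1 = !![0, -1; 1, 0] :=
      ⟨⟨_, by simp [Matrix.det_fin_two_of]⟩, rfl⟩
    refine ⟨P, ?_⟩
    rw [Matrix.SpecialLinearGroup.coe_mul, Matrix.SpecialLinearGroup.coe_mul,
      Matrix.SpecialLinearGroup.coe_inv, hP]
    simp [Matrix.mul_apply, Matrix.vecMul, dotProduct, Matrix.adjugate_fin_two, hb]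
  · obtain ⟨s, hs⟩ := IsAlgClosed.exists_pow_nat_eq
      (discrim (-A.1 0 1) (A.1 0 0 - A.1 1 1) (A.1 1 0)) (n := 2) (by norm_num)
    obtain ⟨t, ht⟩ := exists_quadratic_eq_zero (neg_ne_zero.mpr hb) ⟨s, by rw [← hs, sq]⟩
    obtain ⟨P, hP⟩ : ∃ P : SL2, P.1 = !![1, 0; t, 1] :=
      ⟨⟨_, by simp [Matrix.det_fin_two_of]⟩, rfl⟩
    refine ⟨P, ?_⟩
    rw [Matrix.SpecialLinearGroup.coe_mul, Matrix.SpecialLinearGroup.coe_mul,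
      Matrix.SpecialLinearGroup.coe_inv, hP]
    simp [Matrix.mul_apply, Matrix.vecMul, dotProduct, Matrix.adjugate_fin_two]
    linear_combination ht

/-- Integer powers of `±1` times a unipotent upper triangular matrix. -/
theorem SL2.exists_zpow_eq_of_parabolic {A : SL2} {l u : ℂ}
    (hA : A.1 = !![l, l * u; 0, l]) (n : ℤ) :
    ∃ δ : ℂ, (A ^ n).1 = !![δ, δ * (n * u); 0, δ] := by
  have hA' : (A⁻¹).1 = !![l, -(l * u); 0, l] := by
    rw [Matrix.SpecialLinearGroup.coe_inv, hA, Matrix.adjugate_fin_two_of, neg_zero]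
  induction n using Int.induction_on with
  | zero => exact ⟨1, by simp [Matrix.one_fin_two]⟩
  | succ n ih =>
    obtain ⟨δ, h⟩ := ih
    refine ⟨δ * l, ?_⟩
    rw [_root_.zpow_add_one, Matrix.SpecialLinearGroup.coe_mul, h, hA, Matrix.mul_fin_two]
    congr 3 <;> push_cast <;> ring_nf
  | pred n ih =>
    obtain ⟨δ, h⟩ := ih
    refine ⟨δ * l, ?_⟩
    rw [_root_.zpow_sub_one, Matrix.SpecialLinearGroup.coe_mul, h, hA', Matrix.mul_fin_two]
    congr 3 <;> push_cast <;> ring_nf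

/-- If `x₁, x₂, 𝔪` in `SL₂(ℂ)` satisfy the relations of `Γ_p` and `𝔪` is `±1` times a unipotent
upper triangular matrix, then `x₁` is upper triangular: otherwise the longitude would
be minus a unipotent matrix whose translation length is `± 2 √-3` times that of `𝔪`. -/
theorem SL2.lower_left_eq_zero_of_parabolic {X Y M : SL2} {p : ℤ} {l u : ℂ} (hM : M.1 = !![l, l * u; 0, l]) (h₁ : M * X * Y = X * M) (h₂ : M * Y * X * Y = Y * M)
    (h₃ : X * Y = M ^ (-p) * (Y * X)) : X.1 1 0 = 0 := by
  obtain ⟨δ, hδ⟩ := SL2.exists_zpow_eq_of_parabolic hM (-p)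
  have hl : l * l = 1 := by
    have := M.2
    rw [hM, Matrix.det_fin_two_of] at this
    linear_combination this
  have hdet := X.2
  rw [Matrix.det_fin_two] at hdet
  replace h₁ := congrArg Subtype.val h₁
  replace h₂ := congrArg Subtype.val h₂
  replace h₃ := congrArg Subtype.val h₃
  simp only [Matrix.SpecialLinearGroup.coe_mul, hM, hδ] at h₁ h₂ h₃
  generalize X.1 = A at *
  generalize Y.1 = B at *
  have e₁ (i j) := congrFun (congrFun h₁ i) j
  have e₂ (i j) := congrFun (congrFun h₂ i) j
  have e₃ (i j) := congrFun (congrFun h₃ i) j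
  have e₁00 := e₁ 0 0
  have e₁01 := e₁ 0 1
  have e₁10 := e₁ 1 0
  have e₁11 := e₁ 1 1
  have e₂10 := e₂ 1 0
  have e₂11 := e₂ 1 1
  have e₃00 := e₃ 0 0
  have e₃10 := e₃ 1 0
  clear e₁ e₂ e₃ h₁ h₂ h₃ hM hδ
  simp only [Matrix.mul_apply, Fin.sum_univ_two, Matrix.of_apply, Matrix.cons_val',
    Matrix.cons_val_zero,
    Matrix.cons_val_one, Matrix.cons_val_fin_one] at *
  generalize A 0 0 = a at *
  generalize A 0 1 = b at *
  generalize A 1 0 = c at *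
  generalize A 1 1 = d at *
  generalize B 0 0 = e at *
  generalize B 0 1 = f at *
  generalize B 1 0 = g at *
  generalize B 1 1 = h at *
  by_contra hc
  have p10 : c * e + d * g = c := by linear_combination l * e₁10 + (c - c * e - d * g) * hl
  have p11 : c * f + d * h = u * c + d := by
    linear_combination l * e₁11 + (u * c + d - c * f - d * h) * hl
  have p00 : a * e + b * g = a - u * c := by
    linear_combination l * e₁00 - u * p10 + (a - u * c - a * e - b * g + u * (c - c * e - d * g)) * hl
  have p01 : a * f + b * h = u * a + b - u * (u * c + d) := by
    linear_combination l * e₁01 - u * p11 +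
      (u * a + b - u * (u * c + d) - a * f - b * h + u * (u * c + d - c * f - d * h)) * hl
  have he : e = 1 - u * c * d := by
    linear_combination (1 - e) * hdet + d * p00 - b * p10
  have hf : f = u - u ^ 2 * c * d - u * d ^ 2 := by
    linear_combination (u - f) * hdet + d * p01 - b * p11
  have hg : g = u * c ^ 2 := by
    linear_combination (- g) * hdet - c * p00 + a * p10
  have hh : h = 1 + (u * c) ^ 2 + u * c * d := by
    linear_combination (1 - h) * hdet - c * p01 + a * p11
  have q10 : g * (a - u * c) + h * c = g := by
    linear_combination l * e₂10 - g * p00 - h * p10 -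
      (g * (a * e + b * g) + h * (c * e + d * g) - g) * hl
  have q11 : g * (u * a + b - u * (u * c + d)) + h * (u * c + d) = u * g + h := by
    linear_combination l * e₂11 - g * p01 - h * p11 -
      (g * (a * f + b * h) + h * (c * f + d * h) - u * g - h) * hl
  have k₁ : u * c * (a + d) + 1 - u * c = 0 := by
    apply mul_left_cancel₀ hc
    rw [hg, hh] at q10
    linear_combination q10
  rw [hg, hh] at q11
  have k₂ : (u * c) ^ 2 + u * c + 1 = 0 := by
    linear_combination (u * c + d) * k₁ - q11 - u * c * hdet
  have ht : a + d = 2 + u * c := by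
    linear_combination (u * c) ^ 2 * k₁ + ((a + d) * (1 - u * c) + u * c - 2) * k₂
  have hyx : g * a + h * c = -c := by
    rw [hg, hh]
    linear_combination c * k₁ + c * k₂
  have hδ' : δ = -1 := by
    apply mul_right_cancel₀ hc
    linear_combination δ * hyx + e₃10 - p10
  have k₃ : u * c * (p + 2) = -4 := by
    rw [hδ', he, hf] at e₃00
    push_cast at e₃00
    rw [he] at p00
    linear_combination e₃00 - p00 + p * u * hyx + d * k₁ + d * k₂ - 2 * ht
  have key : (p : ℂ) ^ 2 + 12 = 0 := by
    linear_combination (p + 2 : ℂ) ^ 2 * k₂ - (u * c * (p + 2) - 4 + (p + 2)) * k₃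
  have : p ^ 2 + 12 = 0 := by exact_mod_cast key
  nlinarith [sq_nonneg p]

/-- An upper triangular matrix with distinct diagonal entries is diagonalized by a unipotent. -/
theorem SL2.exists_conj_eq_diagonal {T : SL2} (h₁₀ : T.1 1 0 = 0) (hne : T.1 0 0 ≠ T.1 1 1) :
    ∃ Q : SL2, (Q * T * Q⁻¹).1 = Matrix.diagonal ![T.1 0 0, T.1 1 1] := by
  have hne' := sub_ne_zero.mpr hne
  obtain ⟨Q, hQ⟩ : ∃ Q : SL2, Q.1 = !![1, T.1 0 1 / (T.1 0 0 - T.1 1 1); 0, 1] :=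
    ⟨⟨_, by simp [Matrix.det_fin_two_of]⟩, rfl⟩
  refine ⟨Q, ?_⟩
  rw [Matrix.SpecialLinearGroup.coe_mul, Matrix.SpecialLinearGroup.coe_mul,
    Matrix.SpecialLinearGroup.coe_inv, hQ]
  ext i j
  fin_cases i <;> fin_cases j <;>
    simp [Matrix.mul_apply, Matrix.vecMul, dotProduct, Matrix.adjugate_fin_two, h₁₀]
  field_simp
  ring

/-- A representation of `Γ_p` that is conjugate to one by upper triangular matrices on the
generators `x₁`, `x₂`, `𝔪` is reducible. -/
theorem IsIrrRep.exists_generator_lower_left_ne_zero {p : ℤ} {φ : Gamma p →* SL2}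
    (hφ : IsIrrRep φ) (P : SL2) :
    ∃ i : Fin 3, (P * φ (PresentedGroup.of i) * P⁻¹).1 1 0 ≠ 0 := by
  by_contra! h
  have key (g : Gamma p) : (P * φ g * P⁻¹).1 1 0 = 0 := by
    have hg : g ∈ Subgroup.closure (Set.range (PresentedGroup.of (rels := figRels p))) := by
      rw [PresentedGroup.closure_range_of]
      trivial
    induction hg using Subgroup.closure_induction with
    | mem x hx =>
      obtain ⟨i, rfl⟩ := hx
      exact h i
    | one => simp
    | mul x y _ _ hx hy =>
      have : P * φ (x * y) * P⁻¹ = (P * φ x * P⁻¹) * (P * φ y * P⁻¹) := by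
        rw [map_mul]
        group
      rw [this, Matrix.SpecialLinearGroup.coe_mul, Matrix.mul_apply, Fin.sum_univ_two, hx, hy]
      ring
    | inv x _ hx =>
      have : P * φ x⁻¹ * P⁻¹ = (P * φ x * P⁻¹)⁻¹ := by
        rw [map_inv]
        group
      rw [this, Matrix.SpecialLinearGroup.coe_inv, Matrix.adjugate_fin_two]
      simpa using hx
  refine hφ ⟨(P⁻¹).1 *ᵥ ![1, 0], fun h0 => ?_, fun g => ⟨(P * φ g * P⁻¹).1 0 0, ?_⟩⟩
  · have : P.1 *ᵥ ((P⁻¹).1 *ᵥ ![1, 0]) = ![1, 0] := by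
      rw [Matrix.mulVec_mulVec, ← Matrix.SpecialLinearGroup.coe_mul, mul_inv_cancel,
        Matrix.SpecialLinearGroup.coe_one, Matrix.one_mulVec]
    rw [h0, Matrix.mulVec_zero] at this
    simpa using congrFun this 0
  · have : φ g * P⁻¹ = P⁻¹ * (P * φ g * P⁻¹) := by group
    rw [Matrix.mulVec_mulVec, ← Matrix.SpecialLinearGroup.coe_mul, this,
      Matrix.SpecialLinearGroup.coe_mul, ← Matrix.mulVec_mulVec, ← Matrix.mulVec_smul]
    congr 1
    ext i
    fin_cases i
    · simp [Matrix.mulVec, dotProduct, -Matrix.SpecialLinearGroup.coe_mul]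
    · simpa [Matrix.mulVec, dotProduct, -Matrix.SpecialLinearGroup.coe_mul] using key g

/-- Under an irreducible representation of `Γ_p`, an upper triangular conjugate of the meridian
has distinct diagonal entries. -/
theorem IsIrrRep.diagonal_entries_ne {p : ℤ} {φ : Gamma p →* SL2} (hφ : IsIrrRep φ) {P : SL2}
    (hP : (P * φ (mGen p) * P⁻¹).1 1 0 = 0) :
    (P * φ (mGen p) * P⁻¹).1 0 0 ≠ (P * φ (mGen p) * P⁻¹).1 1 1 := by
  intro heq
  set ψ : Gamma p →* SL2 := (MulAut.conj P).toMonoidHom.comp φ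
  have ψ_apply (g : Gamma p) : ψ g = P * φ g * P⁻¹ := rfl
  have rel {r : FreeGroup (Fin 3)} (hr : r ∈ figRels p) :
      ψ (PresentedGroup.mk (figRels p) r) = 1 := by
    rw [PresentedGroup.one_of_mem hr, map_one]
  have r₁ := rel (Or.inl rfl)
  have r₂ := rel (Or.inr (Or.inl rfl))
  have r₃ := rel (Or.inr (Or.inr rfl))
  obtain ⟨i, hi⟩ := hφ.exists_generator_lower_left_ne_zero P
  simp only [← ψ_apply] at hP heq hi
  have mk_of (i : Fin 3) : PresentedGroup.mk (figRels p) (FreeGroup.of i) =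
    PresentedGroup.of i := rfl
  simp only [map_mul, map_inv, map_zpow, mk_of] at r₁ r₂ r₃
  change (ψ (PresentedGroup.of 2)).1 1 0 = 0 at hP
  change (ψ (PresentedGroup.of 2)).1 0 0 = (ψ (PresentedGroup.of 2)).1 1 1 at heq
  have hgen : (ψ (PresentedGroup.of 0)).1 1 0 ≠ 0 ∨ (ψ (PresentedGroup.of 1)).1 1 0 ≠ 0 ∨
      (ψ (PresentedGroup.of 2)).1 1 0 ≠ 0 := by
    fin_cases i
    exacts [Or.inl hi, Or.inr (Or.inl hi), Or.inr (Or.inr hi)]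
  generalize ψ (PresentedGroup.of 0) = X at *
  generalize ψ (PresentedGroup.of 1) = Y at *
  generalize ψ (PresentedGroup.of 2) = M at *
  have h₁ : M * X * Y = X * M := by
    rwa [mul_inv_eq_one, mul_inv_eq_iff_eq_mul] at r₁
  have h₂ : M * Y * X * Y = Y * M := by
    rwa [mul_inv_eq_one, mul_inv_eq_iff_eq_mul] at r₂
  have h₃ : X * Y = M ^ (-p) * (Y * X) := by
    rw [mul_eq_one_iff_eq_inv, ← _root_.zpow_neg] at r₃
    rw [← r₃]
    group
  have hl : M.1 0 0 * M.1 0 0 = 1 := by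
    have := M.2
    rw [Matrix.det_fin_two, hP, ← heq] at this
    linear_combination this
  have hM' : M.1 = !![M.1 0 0, M.1 0 0 * (M.1 0 0 * M.1 0 1); 0, M.1 0 0] := by
    rw [← mul_assoc, hl, one_mul]
    conv_lhs => rw [Matrix.eta_fin_two M.1, hP, ← heq]
  have hX₁₀ := SL2.lower_left_eq_zero_of_parabolic hM' h₁ h₂ h₃
  have hY' : Y = X⁻¹ * M⁻¹ * X * M := by
    rw [mul_assoc _ X M, ← h₁]
    group
  have hY₁₀ : Y.1 1 0 = 0 := by
    rw [hY']
    simp only [Matrix.SpecialLinearGroup.coe_mul, Matrix.SpecialLinearGroup.coe_inv,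
      Matrix.adjugate_fin_two, Matrix.mul_apply, Fin.sum_univ_two]
    simp [hP, hX₁₀]
  exact hgen.elim (· hX₁₀) (·.elim (· hY₁₀) (· hP))

/-- for nonzero `p`, if `φ : Γ_p → SL₂(ℂ)` is irreducible then `φ(𝔪)` is
diagonalizable: `P ⬝ φ(𝔪) ⬝ P⁻¹ = diag(a, a⁻¹)` for some invertible `P` and `a ∈ ℂˣ`. -/
theorem stmt1 (p : ℤ) (hp : p ≠ 0) (φ : Gamma p →* SL2) (hφ : IsIrrRep φ) :
    ∃ (P : GL (Fin 2) ℂ) (a : ℂˣ),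
      (P : Matrix (Fin 2) (Fin 2) ℂ) * (φ (mGen p) : Matrix (Fin 2) (Fin 2) ℂ) *
          ((P⁻¹ : GL (Fin 2) ℂ) : Matrix (Fin 2) (Fin 2) ℂ) =
        Matrix.diagonal ![(a : ℂ), ((a⁻¹ : ℂˣ) : ℂ)] := by
  obtain ⟨P, hP⟩ := SL2.exists_conj_upperTriangular (φ (mGen p))
  have hne := hφ.diagonal_entries_ne hP
  set T := P * φ (mGen p) * P⁻¹ with hT
  obtain ⟨Q, hQ⟩ := SL2.exists_conj_eq_diagonal hP hne
  have hdet : T.1 0 0 * T.1 1 1 = 1 := by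
    have := T.2
    rw [Matrix.det_fin_two, hP] at this
    linear_combination this
  refine ⟨Matrix.SpecialLinearGroup.toGL (Q * P),
    ⟨T.1 0 0, T.1 1 1, hdet, by rw [mul_comm, hdet]⟩, ?_⟩
  have hconj : Q * T * Q⁻¹ = Q * P * φ (mGen p) * (Q * P)⁻¹ := by
    rw [hT]
    group
  rw [hconj] at hQ
  rw [← map_inv]
  exact hQ
end

section
/- Let p ≥ 5 be an integer. If φ : Γ_p → SL₂(ℂ) is an irreducible representation such that φ(𝔪) is the diagonal matrix diag(a, a⁻¹) for some a ∈ ℂ× with a ∉ {√-1, -√-1}, then Q_p(a) = 0. -/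
open Matrix

/-- The polynomial `Q_p` evaluated at `a ∈ ℂ`. -/
noncomputable def Qc (p : ℤ) (a : ℂ) : ℂ :=
  1 - a ^ (p - 4) + a ^ (p - 2) + 2 * a ^ p + a ^ (p + 2) - a ^ (p + 4) + a ^ (2 * p)

/-- If the generators preserve the line spanned by `v`, then so does the whole group. -/
lemma exists_mulVec_eq_smul {p : ℤ} (φ : Gamma p →* SL2) {v : Fin 2 → ℂ} (hv : v ≠ 0)
    (h : ∀ i : Fin 3, ∃ c : ℂ,
      (φ (PresentedGroup.of i) : Matrix (Fin 2) (Fin 2) ℂ) *ᵥ v = c • v) (g : Gamma p) :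
    ∃ c : ℂ, (φ g : Matrix (Fin 2) (Fin 2) ℂ) *ᵥ v = c • v := by
  have hg : g ∈ Subgroup.closure (Set.range (PresentedGroup.of (rels := figRels p))) := by
    rw [PresentedGroup.closure_range_of]
    trivial
  induction hg using Subgroup.closure_induction with
  | mem x hx =>
    obtain ⟨i, rfl⟩ := hx
    exact h i
  | one => exact ⟨1, by simp⟩
  | mul x y _ _ hx hy =>
    obtain ⟨c, hc⟩ := hx
    obtain ⟨d, hd⟩ := hy
    refine ⟨d * c, ?_⟩
    have hxy : (φ (x * y)).1 = (φ x).1 * (φ y).1 := by rw [map_mul]; rfl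
    rw [hxy, ← mulVec_mulVec, hd, mulVec_smul, hc, smul_smul]
  | inv x _ hx =>
    obtain ⟨c, hc⟩ := hx
    have hxx : (φ x⁻¹).1 * (φ x).1 = 1 :=
      congrArg Subtype.val (show φ x⁻¹ * φ x = 1 by rw [← map_mul, inv_mul_cancel, map_one])
    have hinv : v = c • ((φ x⁻¹ : Matrix (Fin 2) (Fin 2) ℂ) *ᵥ v) := by
      rw [← mulVec_smul, ← hc, mulVec_mulVec, hxx, one_mulVec]
    have hc0 : c ≠ 0 := by
      rintro rfl
      exact hv (by simpa using hinv)
    refine ⟨c⁻¹, ?_⟩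
    conv_rhs => rw [hinv, smul_smul, inv_mul_cancel₀ hc0, one_smul]

/-- The trace of the longitude as a function of the squared meridian eigenvalues `b` and `c`,
where `!![x, y; z, w]` and `!![r, s; u, v]` are the images of `x₁` and `x₂`. -/
lemma commutator_trace {K : Type*} [Field K] {b c x y z w r s u v : K}
    (hbc : b * c = 1) (hX : x * w - y * z = 1) (hY : r * v - s * u = 1)
    (h₁₁ : x * r + y * u = x) (h₁₂ : x * s + y * v = c * y)
    (h₂₁ : z * r + w * u = b * z) (h₂₂ : z * s + w * v = w)
    (k₁₁ : r * x + s * (b * z) = r) (k₂₂ : u * (c * y) + v * w = v)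
    (hy : y ≠ 0) (hz : z ≠ 0) :
    (!![x, y; z, w] * !![r, s; u, v] * !![w, -y; -z, x] * !![v, -s; -u, r]).trace =
      b ^ 2 - b - 2 - c + c ^ 2 := by
  have hr : r = w * x - b * (y * z) := by linear_combination w * h₁₁ - y * h₂₁ - r * hX
  have hs : s = (c - 1) * (w * y) := by linear_combination w * h₁₂ - y * h₂₂ - s * hX
  have hu : u = (b - 1) * (x * z) := by linear_combination x * h₂₁ - z * h₁₁ - u * hX
  have hv : v = w * x - c * (y * z) := by linear_combination x * h₂₂ - z * h₁₂ - v * hX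
  obtain ⟨q, hq⟩ : ∃ q, q = y * z := ⟨_, rfl⟩
  have hq0 : q ≠ 0 := hq ▸ mul_ne_zero hy hz
  obtain ⟨T, hT⟩ : ∃ T, T = 1 - (x + w) := ⟨_, rfl⟩
  have hxw : x * w = 1 + q := by linear_combination hX - hq
  have hx : x = 1 + q * (1 - b) * T := by
    subst hr hs hT
    rw [← hq] at k₁₁
    grind
  have hw : w = 1 + q * (1 - c) * T := by
    subst hu hv hT
    rw [← hq] at k₂₂
    grind
  have hqT : q * (2 - b - c) * T = -1 - T := by linear_combination -hx - hw + hT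
  have hsT : (2 - b - c) * T = 1 + T + T ^ 2 := by
    apply mul_left_cancel₀ hq0
    grind
  have hT0 : T ≠ 0 := by
    rintro rfl
    simp at hsT
  have htr : (!![x, y; z, w] * !![r, s; u, v] * !![w, -y; -z, x] * !![v, -s; -u, r]).trace =
      2 * (x + w) ^ 2 + (r + v) ^ 2 - (x + w) ^ 2 * (r + v) - 2 := by
    calc
      _ = (x + w) ^ 2 * (r * v - s * u) + (r + v) ^ 2 * (x * w - y * z) +
          ((x * r + y * u) + (z * s + w * v)) ^ 2 -
          (x + w) * (r + v) * ((x * r + y * u) + (z * s + w * v)) -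
          2 * (x * w - y * z) * (r * v - s * u) := by
        simp [trace_fin_two]
        ring
      _ = _ := by
        rw [hX, hY, h₁₁, h₂₂]
        ring
  have hrv : r + v = 2 + q * (2 - b - c) := by
    linear_combination hr + hv + 2 * hxw + (b + c) * hq
  rw [htr, hrv]
  apply mul_left_cancel₀ (pow_ne_zero 2 hT0)
  have hxw' : x + w = 1 - T := by linear_combination hT
  rw [hxw']
  have hrvT : (2 + q * (2 - b - c)) * T = T - 1 := by linear_combination hqT
  linear_combination ((2 + q * (2 - b - c)) * T + T - 1 - (1 - T) ^ 2 * T) * hrvT -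
    ((2 - b - c) * T + 1 + T + T ^ 2 - 3 * T) * hsT + 2 * T ^ 2 * hbc

/-- The entries of the relation `M X Y M⁻¹ = X` for a diagonal matrix `M`. -/
lemma entries_of_mul_eq {M X Y : Matrix (Fin 2) (Fin 2) ℂ} {a : ℂ} (ha : a ≠ 0)
    (hM : M = diagonal ![a, a⁻¹]) (h : M * X * Y = X * M) :
    X 0 0 * Y 0 0 + X 0 1 * Y 1 0 = X 0 0 ∧
    X 0 0 * Y 0 1 + X 0 1 * Y 1 1 = a⁻¹ ^ 2 * X 0 1 ∧
    X 1 0 * Y 0 0 + X 1 1 * Y 1 0 = a ^ 2 * X 1 0 ∧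
    X 1 0 * Y 0 1 + X 1 1 * Y 1 1 = X 1 1 := by
  have key : ∀ i j, ![a, a⁻¹] i * (X i 0 * Y 0 j + X i 1 * Y 1 j) = X i j * ![a, a⁻¹] j := by
    intro i j
    have hij := congrFun (congrFun h i) j
    rwa [hM, Matrix.mul_assoc, diagonal_mul, mul_diagonal, Matrix.mul_apply,
      Fin.sum_univ_two] at hij
  have k₀₀ := key 0 0
  have k₀₁ := key 0 1
  have k₁₀ := key 1 0
  have k₁₁ := key 1 1
  simp only [cons_val_zero, cons_val_one] at k₀₀ k₀₁ k₁₀ k₁₁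
  refine ⟨?_, ?_, ?_, ?_⟩
  · exact mul_left_cancel₀ ha (by rw [k₀₀, mul_comm])
  · exact mul_left_cancel₀ ha (by rw [k₀₁]; field_simp)
  · exact mul_left_cancel₀ (inv_ne_zero ha) (by rw [k₁₀]; field_simp)
  · exact mul_left_cancel₀ (inv_ne_zero ha) (by rw [k₁₁, mul_comm])

/-- for `p ≥ 5`, if `φ : Γ_p → SL₂(ℂ)` is irreducible with
`φ(𝔪) = diag(a, a⁻¹)` and `a ∉ {√-1, -√-1}`, then `Q_p(a) = 0`. -/
theorem stmt2 (p : ℤ) (hp : 5 ≤ p) (φ : Gamma p →* SL2) (hφ : IsIrrRep φ)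
    (a : ℂ) (ha0 : a ≠ 0) (haI : a ≠ Complex.I) (haI' : a ≠ -Complex.I)
    (hm : (φ (mGen p) : Matrix (Fin 2) (Fin 2) ℂ) = Matrix.diagonal ![a, a⁻¹]) :
    Qc p a = 0 := by
  have hrel : ∀ r ∈ figRels p, φ (PresentedGroup.mk _ r) = 1 := fun r hr => by
    rw [PresentedGroup.one_of_mem hr, map_one]
  have e₁ := hrel _ (Or.inl rfl)
  have e₂ := hrel _ (Or.inr (Or.inl rfl))
  have e₃ := hrel _ (Or.inr (Or.inr rfl))
  simp only [map_mul, map_inv, map_zpow] at e₁ e₂ e₃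
  change φ (PresentedGroup.of 2) * φ (PresentedGroup.of 0) * φ (PresentedGroup.of 1) *
    (φ (PresentedGroup.of 2))⁻¹ * (φ (PresentedGroup.of 0))⁻¹ = 1 at e₁
  change φ (PresentedGroup.of 2) * φ (PresentedGroup.of 1) * φ (PresentedGroup.of 0) *
    φ (PresentedGroup.of 1) * (φ (PresentedGroup.of 2))⁻¹ * (φ (PresentedGroup.of 1))⁻¹ = 1 at e₂
  change φ (PresentedGroup.of 0) * φ (PresentedGroup.of 1) * (φ (PresentedGroup.of 0))⁻¹ *
    (φ (PresentedGroup.of 1))⁻¹ * φ (PresentedGroup.of 2) ^ p = 1 at e₃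
  change (φ (PresentedGroup.of 2)).1 = _ at hm
  obtain ⟨X, hX⟩ : ∃ X, X = φ (PresentedGroup.of 0) := ⟨_, rfl⟩
  obtain ⟨Y, hY⟩ : ∃ Y, Y = φ (PresentedGroup.of 1) := ⟨_, rfl⟩
  obtain ⟨M, hM⟩ : ∃ M, M = φ (PresentedGroup.of 2) := ⟨_, rfl⟩
  rw [← hX, ← hY, ← hM] at e₁ e₂ e₃
  rw [← hM] at hm
  have hline : ∀ j : Fin 2, ¬ ∀ A ∈ [X, Y, M], ∀ i ≠ j, A.1 i j = 0 := by
    intro j h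
    refine hφ ⟨Pi.single j 1, by simp, exists_mulVec_eq_smul φ (by simp) fun i => ?_⟩
    have hcol : ∀ A ∈ [X, Y, M], ∃ c : ℂ, A.1 *ᵥ Pi.single j 1 = c • Pi.single j 1 := by
      intro A hA
      refine ⟨A.1 j j, ?_⟩
      ext i
      rcases eq_or_ne i j with rfl | hij
      · simp
      · simp [h A hA i hij, hij]
    fin_cases i
    · exact hcol _ (by simp [hX])
    · exact hcol _ (by simp [hY])
    · exact hcol _ (by simp [hM])
  have d₁ : M * X * Y = X * M := by
    rw [mul_inv_eq_one, mul_inv_eq_iff_eq_mul] at e₁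
    exact e₁
  have d₂ : M * Y * (X * Y) = Y * M := by
    rw [mul_inv_eq_one, mul_inv_eq_iff_eq_mul] at e₂
    rw [← e₂]
    group
  have d₃ : X * Y * X⁻¹ * Y⁻¹ = (M ^ p)⁻¹ := eq_inv_of_mul_eq_one_left e₃
  have hXdet := X.2
  have hYdet := Y.2
  rw [det_fin_two] at hXdet hYdet
  obtain ⟨h₁₁, h₁₂, h₂₁, h₂₂⟩ :=
    entries_of_mul_eq ha0 hm (show M.1 * X.1 * Y.1 = X.1 * M.1 from congrArg Subtype.val d₁)
  obtain ⟨k₁₁, -, -, k₂₂⟩ := entries_of_mul_eq ha0 hm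
    (show M.1 * Y.1 * (X.1 * Y.1) = Y.1 * M.1 from congrArg Subtype.val d₂)
  simp only [Matrix.mul_apply, Fin.sum_univ_two] at k₁₁ k₂₂
  rw [h₁₁, h₂₁] at k₁₁
  rw [h₁₂, h₂₂] at k₂₂
  have hy : X.1 0 1 ≠ 0 := by
    intro hy
    refine hline 1 ?_
    simp only [List.forall_mem_cons, Fin.forall_fin_two]
    simp_all
  have hz : X.1 1 0 ≠ 0 := by
    intro hz
    refine hline 0 ?_
    simp only [List.forall_mem_cons, Fin.forall_fin_two]
    simp_all
  have htr := commutator_trace (by field_simp) hXdet hYdet h₁₁ h₁₂ h₂₁ h₂₂ k₁₁ k₂₂ hy hz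
  rw [← eta_fin_two, ← eta_fin_two, ← adjugate_fin_two, ← adjugate_fin_two] at htr
  lift p to ℕ using by lia
  have hpow : (X * Y * X⁻¹ * Y⁻¹).1 = adjugate (diagonal ![a, a⁻¹] ^ p) := by
    rw [d₃, ← hm, zpow_natCast]
    exact (Matrix.SpecialLinearGroup.coe_inv _).trans
      (congrArg adjugate (Matrix.SpecialLinearGroup.coe_pow M p))
  change X.1 * Y.1 * adjugate X.1 * adjugate Y.1 = _ at hpow
  rw [hpow, diagonal_pow, adjugate_fin_two, trace_fin_two] at htr
  simp only [diagonal_apply_eq, Pi.pow_apply, of_apply, cons_val_zero, cons_val_one,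
    cons_val', cons_val_fin_one] at htr
  rw [Qc, zpow_sub₀ ha0, zpow_sub₀ ha0, zpow_add₀ ha0, zpow_add₀ ha0, mul_comm 2 p.cast, _root_.zpow_mul]
  simp only [zpow_natCast, zpow_ofNat]
  have hap : a ^ p * a⁻¹ ^ p = 1 := by rw [← mul_pow, mul_inv_cancel₀ ha0, one_pow]
  simp only [div_eq_mul_inv, ← inv_pow]
  linear_combination a ^ p * htr - hap
end

section
/- Let p ≥ 5 be an integer divisible by 4 and let ε ∈ {1, -1}. Then there exists a group homomorphism φ : Γ_p → SL₂(ℂ) with φ(𝔪) = [[ε√-1, 0], [0, -ε√-1]] and φ(x₁) = [[(-1+ε√5)/4, 1], [(-5-ε√5)/8, (-1+ε√5)/4]], and any such φ is irreducible. -/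
open Matrix

/-- The generator `x₁`. -/
def x1Gen (p : ℤ) : Gamma p := PresentedGroup.of 0

/-- The prescribed value of `φ(𝔪)`. -/
noncomputable def Mmat (ε : ℂ) : Matrix (Fin 2) (Fin 2) ℂ :=
  Matrix.of ![![ε * Complex.I, 0], ![0, -ε * Complex.I]]

/-- The prescribed value of `φ(x₁)`. -/
noncomputable def X1mat (ε : ℂ) : Matrix (Fin 2) (Fin 2) ℂ :=
  Matrix.of ![![(-1 + ε * (Real.sqrt 5 : ℂ)) / 4, 1],
              ![(-5 - ε * (Real.sqrt 5 : ℂ)) / 8, (-1 + ε * (Real.sqrt 5 : ℂ)) / 4]]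

theorem eps_sqrt_five_sq {ε : ℂ} (hε : ε = 1 ∨ ε = -1) : (ε * (Real.sqrt 5 : ℂ)) ^ 2 = 5 := by
  have h5 : ((Real.sqrt 5 : ℂ)) ^ 2 = 5 := by
    rw [← Complex.ofReal_pow, Real.sq_sqrt (by norm_num)]
    norm_num
  rcases hε with rfl | rfl <;> linear_combination h5

theorem det_Mmat {ε : ℂ} (hε : ε = 1 ∨ ε = -1) : (Mmat ε).det = 1 := by
  rcases hε with rfl | rfl <;> simp [Mmat, det_fin_two]

theorem det_X1mat {ε : ℂ} (hε : ε = 1 ∨ ε = -1) : (X1mat ε).det = 1 := by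
  simp only [X1mat, det_fin_two, of_apply, cons_val', cons_val_zero, cons_val_one, cons_val_fin_one]
  linear_combination (1 / 16) * eps_sqrt_five_sq hε

/-- The trace of `X1mat ε` is a root of `t ^ 2 + t - 1`, so it has order five. -/
theorem X1mat_pow_five {ε : ℂ} (hε : ε = 1 ∨ ε = -1) : X1mat ε ^ 5 = 1 := by
  have hs := eps_sqrt_five_sq hε
  rw [X1mat]
  generalize ε * (Real.sqrt 5 : ℂ) = s at hs ⊢
  have h2 : (of ![![(-1 + s) / 4, 1], ![(-5 - s) / 8, (-1 + s) / 4]] : Matrix (Fin 2) (Fin 2) ℂ) ^ 2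
      = of ![![(-1 - s) / 4, (-1 + s) / 2], ![-s / 4, (-1 - s) / 4]] := by
    ext i j
    fin_cases i <;> fin_cases j <;> simp [pow_two, mul_apply, Fin.sum_univ_two]
    · linear_combination (1 / 16) * hs
    · ring
    · linear_combination (-1 / 16) * hs
    · linear_combination (1 / 16) * hs
  have h4 : (of ![![(-1 - s) / 4, (-1 + s) / 2], ![-s / 4, (-1 - s) / 4]] :
      Matrix (Fin 2) (Fin 2) ℂ) ^ 2
      = of ![![(-1 + s) / 4, -1], ![(5 + s) / 8, (-1 + s) / 4]] := by
    ext i j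
    fin_cases i <;> fin_cases j <;> simp [pow_two, mul_apply, Fin.sum_univ_two]
    · linear_combination (-1 / 16) * hs
    · linear_combination (-1 / 4) * hs
    · linear_combination (1 / 8) * hs
    · linear_combination (-1 / 16) * hs
  rw [show 5 = 2 * 2 + 1 from rfl, pow_succ, pow_mul, h2, h4]
  ext i j
  fin_cases i <;> fin_cases j <;> simp [mul_apply, Fin.sum_univ_two]
  · linear_combination (1 / 16) * hs
  · ring
  · linear_combination (1 / 16) * hs

theorem Mmat_pow_four {ε : ℂ} (hε : ε = 1 ∨ ε = -1) : Mmat ε ^ 4 = 1 := by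
  have h2 : Mmat ε ^ 2 = -1 := by
    rcases hε with rfl | rfl <;> ext i j <;> fin_cases i <;> fin_cases j <;>
      simp [Mmat, pow_two, mul_apply, Fin.sum_univ_two]
  rw [show 4 = 2 * 2 from rfl, pow_mul, h2, neg_one_sq]

theorem X1mat_mul_Mmat_mul_X1mat {ε : ℂ} (hε : ε = 1 ∨ ε = -1) :
    X1mat ε * Mmat ε * X1mat ε = Mmat ε := by
  have hs := eps_sqrt_five_sq hε
  rw [X1mat]
  generalize ε * (Real.sqrt 5 : ℂ) = s at hs ⊢
  ext i j
  fin_cases i <;> fin_cases j <;> simp [Mmat, mul_apply, Fin.sum_univ_two]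
  · linear_combination (1 / 16) * ε * Complex.I * hs
  · ring
  · ring
  · linear_combination (-1 / 16) * ε * Complex.I * hs

/-- Elements `x`, `m` with `x ^ 5 = 1`, `m ^ 4 = 1` and `x * m * x = m` define a homomorphism on
`Gamma p` when `4 ∣ p`, sending `x₂` to `x⁻²`. -/
theorem exists_hom_of_relations {G : Type*} [Group G] {p : ℤ} (hp4 : (4 : ℤ) ∣ p) {x m : G}
    (hx : x ^ 5 = 1) (hm : m ^ 4 = 1) (hxm : x * m * x = m) :
    ∃ φ : Gamma p →* G, φ (mGen p) = m ∧ φ (x1Gen p) = x := by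
  have hconj : m * x * m⁻¹ = x⁻¹ := by
    rw [mul_inv_eq_iff_eq_mul, eq_inv_mul_iff_mul_eq, ← mul_assoc, hxm]
  have hmp : m ^ p = 1 := by
    obtain ⟨k, rfl⟩ := hp4
    rw [_root_.zpow_mul, show m ^ (4 : ℤ) = 1 from mod_cast hm, _root_.one_zpow]
  have hrel : ∀ r ∈ figRels p, FreeGroup.lift ![x, (x ^ 2)⁻¹, m] r = 1 := by
    rintro r (rfl | rfl | rfl) <;>
      simp only [map_mul, map_inv, map_zpow, FreeGroup.lift_apply_of, cons_val_zero, cons_val_one,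
        cons_val]
    · calc m * x * (x ^ 2)⁻¹ * m⁻¹ * x⁻¹ = (m * x * m⁻¹)⁻¹ * x⁻¹ := by group
        _ = 1 := by rw [hconj]; group
    · calc m * (x ^ 2)⁻¹ * x * (x ^ 2)⁻¹ * m⁻¹ * (x ^ 2)⁻¹⁻¹
          = (m * x ^ 3 * m⁻¹)⁻¹ * x ^ 2 := by group
        _ = 1 := by rw [← conj_pow, hconj, inv_pow, inv_inv, ← pow_add, hx]
    · rw [hmp]
      group
  refine ⟨PresentedGroup.toGroup hrel, ?_, ?_⟩
  · simp [mGen]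
  · simp [x1Gen]

/-- No line is invariant under both `Mmat ε` and `X1mat ε`. -/
theorem eq_zero_of_Mmat_X1mat_eigenvector {ε : ℂ} (hε : ε = 1 ∨ ε = -1) {v : Fin 2 → ℂ} {a b : ℂ}
    (ha : Mmat ε *ᵥ v = a • v) (hb : X1mat ε *ᵥ v = b • v) : v = 0 := by
  have hs := eps_sqrt_five_sq hε
  have hε0 : ε ≠ 0 := by rcases hε with rfl | rfl <;> norm_num
  rw [X1mat] at hb
  generalize ε * (Real.sqrt 5 : ℂ) = s at hs hb
  have hs5 : -5 - s ≠ 0 := fun h => by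
    have : (20 : ℂ) = 0 := by linear_combination hs + (s - 5) * h
    norm_num at this
  have ha0 := congrFun ha 0
  have ha1 := congrFun ha 1
  have hb0 := congrFun hb 0
  have hb1 := congrFun hb 1
  simp [Mmat, mulVec, dotProduct, Fin.sum_univ_two] at ha0 ha1 hb0 hb1
  have h : v 0 = 0 ∨ v 1 = 0 := by
    refine ha0.symm.imp_right fun haε => ?_
    have h2 : 2 * (ε * Complex.I) * v 1 = 0 := by
      linear_combination v 1 * haε - ha1
    simpa [hε0] using h2
  ext i
  rcases h with h | h
  · have h1 : v 1 = 0 := by simpa [h] using hb0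
    fin_cases i <;> simp [h, h1]
  · have h0 : v 0 = 0 := by simpa [h, hs5] using hb1
    fin_cases i <;> simp [h, h0]

/-- for `p ≥ 5` divisible by `4` and `ε = ±1`, there exists a homomorphism
`φ : Γ_p → SL₂(ℂ)` with the prescribed values of `φ(𝔪)` and `φ(x₁)`, and any such `φ` is
irreducible. -/
theorem stmt3 (p : ℤ) (hp : 5 ≤ p) (hp4 : (4 : ℤ) ∣ p) (ε : ℂ) (hε : ε = 1 ∨ ε = -1) :
    (∃ φ : Gamma p →* SL2,
       (φ (mGen p) : Matrix (Fin 2) (Fin 2) ℂ) = Mmat ε ∧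
       (φ (x1Gen p) : Matrix (Fin 2) (Fin 2) ℂ) = X1mat ε) ∧
    (∀ φ : Gamma p →* SL2,
       (φ (mGen p) : Matrix (Fin 2) (Fin 2) ℂ) = Mmat ε →
       (φ (x1Gen p) : Matrix (Fin 2) (Fin 2) ℂ) = X1mat ε →
       IsIrrRep φ) := by
  refine ⟨?_, fun φ hm hx ⟨v, hv, hinv⟩ => ?_⟩
  · let x : SL2 := ⟨X1mat ε, det_X1mat hε⟩
    let m : SL2 := ⟨Mmat ε, det_Mmat hε⟩
    have hx5 : x ^ 5 = 1 := Subtype.ext (X1mat_pow_five hε)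
    have hm4 : m ^ 4 = 1 := Subtype.ext (Mmat_pow_four hε)
    have hxm : x * m * x = m := Subtype.ext (X1mat_mul_Mmat_mul_X1mat hε)
    obtain ⟨φ, hm, hx⟩ := exists_hom_of_relations hp4 hx5 hm4 hxm
    exact ⟨φ, by rw [hm], by rw [hx]⟩
  · obtain ⟨a, ha⟩ := hinv (mGen p)
    obtain ⟨b, hb⟩ := hinv (x1Gen p)
    rw [hm] at ha
    rw [hx] at hb
    exact hv (eq_zero_of_Mmat_X1mat_eigenvector hε ha hb)
end

section
/- Let p ≥ 5 be an odd integer. Then (1+X)² divides Q_p(X) in ℤ[X], and the quotient Q_p(X)/(1+X)² has no repeated complex roots and is divisible by none of X+1, X-1, and X²+1. -/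
open Polynomial

/-- The polynomial `Q_p(X) = 1 - X^(p-4) + X^(p-2) + 2X^p + X^(p+2) - X^(p+4) + X^(2p)` in `ℤ[X]`
(for `p ≥ 5`). -/
noncomputable def Qp (p : ℕ) : Polynomial ℤ :=
  1 - X ^ (p - 4) + X ^ (p - 2) + 2 * X ^ p + X ^ (p + 2) - X ^ (p + 4) + X ^ (2 * p)

theorem Qp_odd (k : ℕ) : Qp (2 * k + 5) =
    1 - X ^ (2 * k + 1) + X ^ (2 * k + 3) + 2 * X ^ (2 * k + 5) + X ^ (2 * k + 7)
      - X ^ (2 * k + 9) + X ^ (4 * k + 10) := by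
  rw [Qp, show 2 * k + 5 - 4 = 2 * k + 1 by omega, show 2 * k + 5 - 2 = 2 * k + 3 by omega,
    show 2 * (2 * k + 5) = 4 * k + 10 by ring]

theorem Qp_monic (k : ℕ) : (Qp (2 * k + 5)).Monic := by
  rw [Qp_odd, add_comm]
  refine monic_X_pow_add (lt_of_le_of_lt (b := ((2 * k + 9 : ℕ) : WithBot ℕ)) ?_ ?_)
  · rw [← natDegree_le_iff_degree_le]
    compute_degree
  · exact_mod_cast (by omega : 2 * k + 9 < 4 * k + 10)

theorem aeval_Qp (k : ℕ) (a : ℂ) : aeval a (Qp (2 * k + 5)) =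
    1 - a ^ (2 * k + 1) + a ^ (2 * k + 3) + 2 * a ^ (2 * k + 5) + a ^ (2 * k + 7)
      - a ^ (2 * k + 9) + a ^ (4 * k + 10) := by
  simp [Qp_odd, map_ofNat]

theorem aeval_derivative_Qp (k : ℕ) (a : ℂ) : aeval a (derivative (Qp (2 * k + 5))) =
    - (2 * k + 1) * a ^ (2 * k) + (2 * k + 3) * a ^ (2 * k + 2)
      + 2 * (2 * k + 5) * a ^ (2 * k + 4) + (2 * k + 7) * a ^ (2 * k + 6)
      - (2 * k + 9) * a ^ (2 * k + 8) + (4 * k + 10) * a ^ (4 * k + 9) := by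
  simp [Qp_odd, map_ofNat]
  ring

theorem aeval_Qp_ne_zero_of_sq_eq_neg_one (k : ℕ) {a : ℂ} (ha : a ^ 2 = -1) :
    aeval a (Qp (2 * k + 5)) ≠ 0 := by
  have ha0 : a ≠ 0 := by rintro rfl; norm_num at ha
  have hw : (a ^ (2 * k + 1)) ^ 2 = -1 := by
    rw [← pow_mul, mul_comm, pow_mul, ha, pow_succ, pow_mul]
    norm_num
  have hQ : aeval a (Qp (2 * k + 5)) = -2 * a ^ (2 * k + 1) := by
    rw [aeval_Qp]
    generalize hwa : a ^ (2 * k + 1) = w at hw ⊢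
    calc _ = 1 - w + w * a ^ 2 + 2 * w * (a ^ 2) ^ 2 + w * (a ^ 2) ^ 3 - w * (a ^ 2) ^ 4
          + w ^ 2 * (a ^ 2) ^ 4 := by rw [← hwa]; ring
      _ = -2 * w := by rw [ha]; linear_combination hw
  rw [hQ]
  exact mul_ne_zero (by norm_num) (pow_ne_zero _ ha0)

theorem aeval_one_Qp (k : ℕ) : aeval (1 : ℂ) (Qp (2 * k + 5)) = 4 := by
  rw [aeval_Qp]; norm_num

/-- The quotient of `Q_p` by `(1 + X)²`, with its value at `-1` determined by `Q_p''(-1)`. -/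
theorem exists_Qp_eq_sq_mul (k : ℕ) :
    ∃ q : ℤ[X], Qp (2 * k + 5) = (1 + X) ^ 2 * q ∧ q.eval (-1) ≠ 0 := by
  have h0 : (Qp (2 * k + 5)).eval (-1) = 0 := by
    rw [Qp_odd, show 4 * k + 10 = 2 * (2 * k + 5) by ring]
    simp [pow_add, pow_mul]
  have h1 : (derivative (Qp (2 * k + 5))).eval (-1) = 0 := by
    rw [Qp_odd]
    simp only [derivative_add, derivative_sub, derivative_mul, derivative_X_pow, derivative_one]
    simp [pow_add, pow_mul]
    ring
  have h2 : (derivative (derivative (Qp (2 * k + 5)))).eval (-1) =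
      2 * ((2 * k + 5) ^ 2 + 12) := by
    rw [Qp_odd]
    simp only [derivative_add, derivative_sub, derivative_mul, derivative_X_pow, derivative_one]
    simp [pow_add, pow_mul]
    have hk : (k : ℤ) * (-1) ^ (2 * k - 1) = -k := by
      cases k
      · simp
      · simp [mul_add, pow_add, pow_mul]
    linear_combination (-2 - 4 * (k : ℤ)) * hk
  obtain ⟨r, hr⟩ := dvd_iff_isRoot.2 (show IsRoot _ _ from h0)
  have hr1 : r.eval (-1) = 0 := by
    rw [hr] at h1
    simpa [derivative_mul] using h1
  obtain ⟨q, hq⟩ := dvd_iff_isRoot.2 (show IsRoot _ _ from hr1)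
  have hQ : Qp (2 * k + 5) = (1 + X) ^ 2 * q := by
    rw [hr, hq]; simp; ring
  refine ⟨q, hQ, fun hq0 => ?_⟩
  rw [hQ] at h2
  simp [derivative_mul, derivative_pow, hq0] at h2
  nlinarith [sq_nonneg (2 * (k : ℤ) + 5)]

/-- Eliminating `a ^ p` from `Q_p(a) = Q_p'(a) = 0` leaves a quadratic equation for
`a ^ 2 + a ^ (-2)`. -/
theorem quadratic_of_double_root {k : ℕ} {a : ℂ} (ha : a ≠ -1)
    (h0 : aeval a (Qp (2 * k + 5)) = 0) (h1 : aeval a (derivative (Qp (2 * k + 5))) = 0) :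
    4 * (2 * (a ^ 2 + a⁻¹ ^ 2) - 1) ^ 2 =
      (2 * k + 5) ^ 2 * ((a ^ 2 + a⁻¹ ^ 2 - 3) * (a ^ 2 + a⁻¹ ^ 2 + 1)) := by
  have ha0 : a ≠ 0 := by rintro rfl; simp [aeval_Qp] at h0
  have hb1 : a ^ 2 ≠ 1 := by
    intro h
    rcases eq_or_eq_neg_of_sq_eq_sq a 1 (h.trans (one_pow 2).symm) with rfl | h
    · norm_num [aeval_one_Qp] at h0
    · exact ha h
  have hb2 : a ^ 2 ≠ -1 := fun h => aeval_Qp_ne_zero_of_sq_eq_neg_one k h h0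
  rw [aeval_Qp] at h0
  rw [aeval_derivative_Qp] at h1
  obtain ⟨c, hc⟩ : ∃ c, c = a⁻¹ ^ 2 := ⟨_, rfl⟩
  obtain ⟨b, hb⟩ : ∃ b, b = a ^ 2 := ⟨_, rfl⟩
  obtain ⟨W, hW⟩ : ∃ W, W = a ^ (2 * k + 5) := ⟨_, rfl⟩
  obtain ⟨P, hP⟩ : ∃ P : ℂ, P = 2 * k + 5 := ⟨_, rfl⟩
  have hW0 : W ≠ 0 := hW ▸ pow_ne_zero _ ha0
  have hbc : b * c = 1 := by rw [hb, hc]; field_simp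
  have e1 : 1 + (4 + (b + c) - (b + c) ^ 2) * W + W ^ 2 = 0 := by
    rw [← h0, hb, hc, hW]
    field_simp
    ring
  have e2 : 2 * P * W + P * (4 + (b + c) - (b + c) ^ 2) + 2 * (b - c) * (1 - 2 * (b + c)) = 0 := by
    refine (mul_eq_zero.1 (?_ : W * _ = 0)).resolve_left hW0
    rw [← mul_zero a, ← h1, hb, hc, hW, hP]
    field_simp
    ring
  have hbc' : b - c ≠ 0 := by
    intro h
    have : (b - 1) * (b + 1) = 0 := by linear_combination b * h + hbc
    rcases mul_eq_zero.1 this with h | h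
    · exact hb1 (by rw [← hb]; linear_combination h)
    · exact hb2 (by rw [← hb]; linear_combination h)
  rw [← hc, ← hb, ← hP]
  refine mul_left_cancel₀ (pow_ne_zero 2 hbc') ?_
  obtain ⟨t, ht⟩ : ∃ t, t = b + c := ⟨_, rfl⟩
  have hs : (b - c) ^ 2 = t ^ 2 - 4 := by rw [ht]; linear_combination -4 * hbc
  rw [← ht] at e1 e2 ⊢
  linear_combination (2 * (b - c) * (1 - 2 * t) - P * (2 * W + (4 + t - t ^ 2))) * e2
    + 4 * P ^ 2 * e1 - P ^ 2 * (t - 3) * (t + 1) * hs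

/-- `Q_p` is monic and self-reciprocal, so its roots are units among the algebraic integers. -/
theorem isIntegral_sq_add_inv_sq {k : ℕ} {a : ℂ} (h0 : aeval a (Qp (2 * k + 5)) = 0) :
    IsIntegral ℤ (a ^ 2 + a⁻¹ ^ 2) := by
  have ha : IsIntegral ℤ a := ⟨_, Qp_monic k, h0⟩
  have ha0 : a ≠ 0 := by rintro rfl; simp [aeval_Qp] at h0
  have hinv : aeval a⁻¹ (Qp (2 * k + 5)) = 0 := by
    rw [aeval_Qp] at h0 ⊢
    rw [← mul_zero (a⁻¹ ^ (4 * k + 10)), ← h0]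
    simp only [inv_pow]
    field_simp
    ring
  have hi : IsIntegral ℤ a⁻¹ := ⟨_, Qp_monic k, hinv⟩
  exact (ha.pow 2).add (hi.pow 2)

theorem quadratic_ne_zero_of_int (k : ℕ) (s : ℤ) :
    4 * (2 * s - 1) ^ 2 ≠ (2 * k + 5) ^ 2 * ((s - 3) * (s + 1)) := by
  intro h
  obtain ⟨u, rfl | rfl⟩ := s.even_or_odd'
  · have h2 := congrArg (Int.cast : ℤ → ZMod 2) h
    push_cast at h2
    generalize (u : ZMod 2) = u, (k : ZMod 2) = k at h2
    revert u k
    decide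
  · have h' : (4 * u + 1) ^ 2 = (2 * (k : ℤ) + 5) ^ 2 * ((u - 1) * (u + 1)) :=
      mul_left_cancel₀ (four_ne_zero (α := ℤ)) (by linear_combination h)
    have h8 := congrArg (Int.cast : ℤ → ZMod 8) h'
    push_cast at h8
    generalize (u : ZMod 8) = u, (k : ZMod 8) = k at h8
    revert u k
    decide

/-- The quadratic equation for `t` is primitive over `ℤ` with leading coefficient `p² - 16 ≠ ±1`,
and it has no integer solution. -/
theorem not_isIntegral_of_quadratic {k : ℕ} {t : ℂ}
    (h : 4 * (2 * t - 1) ^ 2 = (2 * k + 5) ^ 2 * ((t - 3) * (t + 1))) :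
    ¬ IsIntegral ℤ t := by
  intro ht
  obtain ⟨n, hn⟩ : ∃ n : ℤ, n = (2 * k + 5) ^ 2 - 16 := ⟨_, rfl⟩
  have hn9 : 9 ≤ n := by rw [hn]; nlinarith [Int.natCast_nonneg k]
  have hdvd : minpoly ℤ t ∣ C n * X ^ 2 + C (-2 * n - 16) * X + C (-3 * n - 52) := by
    refine minpoly.isIntegrallyClosed_dvd ht ?_
    simp [hn, map_ofNat]
    linear_combination -h
  obtain ⟨r, hr⟩ := hdvd
  have hm := minpoly.monic ht
  have hpos := minpoly.natDegree_pos ht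
  have hdeg : (minpoly ℤ t).natDegree + r.natDegree = 2 := by
    have hr0 : r ≠ 0 := by
      rintro rfl
      have := natDegree_quadratic (R := ℤ) (a := n) (b := -2 * n - 16) (c := -3 * n - 52) (by omega)
      rw [hr] at this
      simp at this
    rw [← hm.natDegree_mul' hr0, ← hr]
    exact natDegree_quadratic (by omega)
  obtain h1 | h2 : (minpoly ℤ t).natDegree = 1 ∨ r.natDegree = 0 := by omega
  · have hl := minpoly.aeval ℤ t
    rw [hm.eq_X_add_C h1] at hl
    simp only [map_add, aeval_X, eq_intCast, map_intCast] at hl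
    rw [eq_neg_of_add_eq_zero_left hl] at h
    refine quadratic_ne_zero_of_int k (-(minpoly ℤ t).coeff 0) ?_
    exact_mod_cast h
  · obtain ⟨c, rfl⟩ := natDegree_eq_zero.1 h2
    have hc2 := congrArg (coeff · 2) hr
    have hc1 := congrArg (coeff · 1) hr
    have hm2 : (minpoly ℤ t).coeff 2 = 1 := by
      have := hm.coeff_natDegree
      rwa [show (minpoly ℤ t).natDegree = 2 by simpa using hdeg] at this
    simp only [coeff_add, coeff_C_mul, coeff_X_pow, coeff_X, coeff_C, coeff_mul_C, hm2] at hc2 hc1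
    norm_num at hc2 hc1
    subst hc2
    have hdvd : n ∣ 16 := ⟨-2 - (minpoly ℤ t).coeff 1, by linear_combination -hc1⟩
    have hle := Int.le_of_dvd (by norm_num) hdvd
    have hodd : n = 2 * (2 * (k : ℤ) ^ 2 + 10 * k + 4) + 1 := by rw [hn]; ring
    generalize 2 * (k : ℤ) ^ 2 + 10 * k + 4 = m at hodd
    clear * - hdvd hle hn9 hodd
    interval_cases n <;> omega

/-- for odd `p ≥ 5`, `(1+X)²` divides `Q_p` in `ℤ[X]`, and the quotient has
no repeated complex roots and is divisible by none of `X+1`, `X-1`, `X²+1`. -/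
theorem stmt4 (p : ℕ) (hp : 5 ≤ p) (hodd : Odd p) :
    ∃ q : Polynomial ℤ, Qp p = (1 + X) ^ 2 * q ∧
      (∀ a : ℂ, (q.map (Int.castRingHom ℂ)).rootMultiplicity a ≤ 1) ∧
      ¬ (X + 1 ∣ q) ∧ ¬ (X - 1 ∣ q) ∧ ¬ (X ^ 2 + 1 ∣ q) := by
  obtain ⟨k, rfl⟩ : ∃ k, p = 2 * k + 5 := by
    obtain ⟨m, rfl⟩ := hodd
    exact ⟨m - 2, by omega⟩
  obtain ⟨q, hQ, hq⟩ := exists_Qp_eq_sq_mul k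
  have hqQ : q ∣ Qp (2 * k + 5) := ⟨_, hQ.trans (mul_comm _ _)⟩
  refine ⟨q, hQ, fun a => ?_, ?_, ?_, ?_⟩
  · by_contra! hlt
    have hq0 : q.map (Int.castRingHom ℂ) ≠ 0 := by
      rintro h
      simp [h] at hlt
    have hd : (X - C a) ^ 2 ∣ (Qp (2 * k + 5)).map (Int.castRingHom ℂ) :=
      ((le_rootMultiplicity_iff hq0).1 hlt).trans (map_dvd (mapRingHom _) hqQ)
    have ha : a ≠ -1 := by
      rintro rfl
      have hroot : IsRoot (q.map (Int.castRingHom ℂ)) (-1) :=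
        (rootMultiplicity_pos hq0).1 (by omega)
      have : ((q.eval (-1) : ℤ) : ℂ) = 0 := by
        rw [← hroot.eq_zero, eval_map]
        simpa using (eval₂_at_apply (Int.castRingHom ℂ) (p := q) (-1)).symm
      exact hq (by exact_mod_cast this)
    obtain ⟨r, hr⟩ := hd
    have h0 : aeval a (Qp (2 * k + 5)) = 0 := by
      rw [← eval_map_algebraMap, algebraMap_int_eq, hr]
      simp
    have h1 : aeval a (derivative (Qp (2 * k + 5))) = 0 := by
      rw [← eval_map_algebraMap, ← derivative_map, algebraMap_int_eq, hr]
      simp [derivative_mul, derivative_pow]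
    exact not_isIntegral_of_quadratic (quadratic_of_double_root ha h0 h1)
      (isIntegral_sq_add_inv_sq h0)
  · rintro ⟨r, rfl⟩
    simp at hq
  · intro h
    obtain ⟨r, hr⟩ := h.trans hqQ
    have := aeval_one_Qp k
    norm_num [hr] at this
  · intro h
    obtain ⟨r, hr⟩ := h.trans hqQ
    refine aeval_Qp_ne_zero_of_sq_eq_neg_one k Complex.I_sq ?_
    simp [hr]
end

section
/- Let q ≥ 1 be an integer. Then (1+X)² divides Qq(X) in ℤ[X], (1+X)³ does not divide Qq(X), and the quotient Qq(X)/(1+X)² has no repeated complex roots. -/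
open Polynomial

/-- The polynomial `Qq(X) = 1 - X^(2q) - X^(4q-1) - 2X^(4q) - X^(4q+1) - X^(6q) + X^(8q)`
in `ℤ[X]` (for `q ≥ 1`). -/
noncomputable def Qq (q : ℕ) : Polynomial ℤ :=
  1 - X ^ (2 * q) - X ^ (4 * q - 1) - 2 * X ^ (4 * q) - X ^ (4 * q + 1) - X ^ (6 * q) +
    X ^ (8 * q)

theorem Qq_succ (k : ℕ) :
    Qq (k + 1) = X ^ (8 * k + 8) + (1 - X ^ (2 * k + 2) - X ^ (4 * k + 3) - 2 * X ^ (4 * k + 4)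
      - X ^ (4 * k + 5) - X ^ (6 * k + 6)) := by
  have h : 4 * (k + 1) - 1 = 4 * k + 3 := by omega
  rw [Qq, h]
  ring

theorem monic_Qq_succ (k : ℕ) : (Qq (k + 1)).Monic := by
  rw [Qq_succ]
  apply monic_X_pow_add
  rw [degree_lt_iff_coeff_zero]
  intro m hm
  simp only [coeff_sub, coeff_one, coeff_ofNat_mul, coeff_X_pow]
  rw [if_neg (by omega), if_neg (by omega), if_neg (by omega), if_neg (by omega),
    if_neg (by omega), if_neg (by omega)]
  norm_num

theorem eval_neg_one_Qq_succ (k : ℕ) : (Qq (k + 1)).eval (-1) = 0 := by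
  rw [Qq_succ]
  simp [pow_add, pow_mul]

theorem eval_neg_one_derivative_Qq_succ (k : ℕ) : (derivative (Qq (k + 1))).eval (-1) = 0 := by
  rw [Qq_succ]
  simp
  simp [pow_add, pow_mul, Odd.neg_one_pow (show Odd 3 by decide)]
  ring

theorem eval_neg_one_derivative_derivative_Qq_succ (k : ℕ) :
    (derivative (derivative (Qq (k + 1)))).eval (-1) = 24 * ((k : ℤ) + 1) ^ 2 + 2 := by
  rw [Qq_succ]
  simp
  simp [pow_add, pow_mul, Odd.neg_one_pow (show Odd 3 by decide)]
  ring

theorem sq_one_add_X_dvd_of_eval {p : ℤ[X]} (h : p.eval (-1) = 0)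
    (h' : (derivative p).eval (-1) = 0) : (1 + X) ^ 2 ∣ p := by
  have hX : (X - C (-1) : ℤ[X]) = 1 + X := by simp [add_comm]
  obtain ⟨s, rfl⟩ := hX ▸ dvd_iff_isRoot.mpr h
  have hs : s.IsRoot (-1) := by simpa [derivative_mul] using h'
  rw [pow_two]
  exact mul_dvd_mul_left _ (hX ▸ dvd_iff_isRoot.mpr hs)

theorem not_one_add_X_pow_three_dvd_Qq_succ (k : ℕ) : ¬ (1 + X) ^ 3 ∣ Qq (k + 1) := by
  rintro ⟨s, hs⟩
  have h := eval_neg_one_derivative_derivative_Qq_succ k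
  rw [hs] at h
  simp [derivative_mul, derivative_pow] at h
  nlinarith

/-- An algebraic integer is not a root of `A X² - (A - 1) X + C` when this integer polynomial has
negative discriminant and `A > 1`. -/
theorem quadratic_ne_zero_of_isIntegral {u : ℂ} (hu : IsIntegral ℤ u) {A C : ℤ} (hA : 1 < A)
    (hdisc : (A - 1) ^ 2 - 4 * A * C < 0) :
    (A : ℂ) * u ^ 2 - ((A : ℂ) - 1) * u + C ≠ 0 := by
  intro h
  have hc := congrArg (starRingEnd ℂ) h
  simp only [map_add, map_sub, map_mul, map_pow, map_intCast, map_one, map_zero] at hc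
  set v := starRingEnd ℂ u with hv
  have hvi : IsIntegral ℤ v := hu.map ((starRingEnd ℂ).toIntAlgHom)
  have hne : u - v ≠ 0 := by
    intro huv
    obtain ⟨x, hx⟩ := Complex.conj_eq_iff_real.mp (sub_eq_zero.mp huv).symm
    rw [hx] at h
    have h1 : (A : ℝ) * x ^ 2 - ((A : ℝ) - 1) * x + C = 0 := by exact_mod_cast h
    have h2 : ((A : ℝ) - 1) ^ 2 - 4 * A * C < 0 := by exact_mod_cast hdisc
    linarith [sq_nonneg (2 * (A : ℝ) * x - (A - 1)), congrArg (4 * (A : ℝ) * ·) h1]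
  have hsum : (A : ℂ) * (u + v) - (A - 1) = 0 := by
    apply (mul_eq_zero.mp _).resolve_left hne
    linear_combination h - hc
  have hA0 : (A : ℂ) ≠ 0 := by exact_mod_cast (by omega : A ≠ 0)
  have hw : 1 - (u + v) = algebraMap ℚ ℂ (1 / A) := by
    simp only [map_div₀, map_one, map_intCast]
    field_simp
    linear_combination -hsum
  have hi : IsIntegral ℤ (algebraMap ℚ ℂ (1 / A)) := hw ▸ isIntegral_one.sub (hu.add hvi)
  rw [isIntegral_algebraMap_iff (algebraMap ℚ ℂ).injective] at hi
  obtain ⟨m, hm⟩ := IsIntegrallyClosed.isIntegral_iff.mp hi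
  have hAq : (A : ℚ) ≠ 0 := by exact_mod_cast (by omega : A ≠ 0)
  have hmA : m * A = 1 := by
    have : (m : ℚ) * A = 1 := by
      rw [show (m : ℚ) = 1 / A from hm]
      field_simp
    exact_mod_cast this
  have := Int.le_of_dvd one_pos (Dvd.intro_left m hmA)
  omega

theorem eq_neg_one_of_aeval_Qq_succ {k : ℕ} {a : ℂ} (h : (Qq (k + 1)).aeval a = 0)
    (h' : (derivative (Qq (k + 1))).aeval a = 0) : a = -1 := by
  have hai : IsIntegral ℤ a := ⟨_, monic_Qq_succ k, h⟩
  rw [Qq_succ] at h h'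
  simp [map_ofNat] at h h'
  have ha : a ≠ 0 := by
    rintro rfl
    simp at h
  obtain ⟨b, hab⟩ : ∃ b, a * b = 1 := ⟨a⁻¹, mul_inv_cancel₀ ha⟩
  have hb : b = a ^ (2 * k + 1) + a ^ (4 * k + 2) + 2 * a ^ (4 * k + 3) + a ^ (4 * k + 4)
      + a ^ (6 * k + 5) - a ^ (8 * k + 7) := by
    apply mul_left_cancel₀ ha
    linear_combination hab + h
  have h2i : IsIntegral ℤ (2 : ℂ) := isIntegral_algebraMap (R := ℤ) (x := 2)
  have hbi : IsIntegral ℤ b := by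
    rw [hb]
    exact (((((hai.pow _).add (hai.pow _)).add (h2i.mul (hai.pow _))).add (hai.pow _)).add
      (hai.pow _)).sub (hai.pow _)
  obtain ⟨y, hy⟩ : ∃ y, y = a ^ (2 * k + 2) := ⟨_, rfl⟩
  obtain ⟨z, hz⟩ : ∃ z, z = b ^ (2 * k + 2) := ⟨_, rfl⟩
  have hyz : y * z = 1 := by rw [hy, hz, ← mul_pow, hab, one_pow]
  have hui : IsIntegral ℤ (y + z) := by
    rw [hy, hz]
    exact (hai.pow _).add (hbi.pow _)
  have hy0 : y ≠ 0 := left_ne_zero_of_mul_eq_one hyz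
  have e1 : a ^ (4 * k + 3) = y ^ 2 * b := by
    rw [hy]
    linear_combination -a ^ (4 * k + 3) * hab
  have ht : a + b = (y + z) ^ 2 - (y + z) - 4 := by
    apply mul_left_cancel₀ (pow_ne_zero 2 hy0)
    have h1 : y ^ 4 + (1 - y - y ^ 2 * b - 2 * y ^ 2 - y ^ 2 * a - y ^ 3) = 0 := by
      rw [← e1, hy]
      linear_combination h
    linear_combination -h1 - (y * z + 1 + 2 * y ^ 2 - y) * hyz
  have hd : 2 * ((k : ℂ) + 1) * (y - z) * (2 * (y + z) - 1) = a - b := by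
    apply mul_left_cancel₀ (pow_ne_zero 2 hy0)
    have h2 : 8 * (k + 1) * y ^ 4 - 2 * (k + 1) * y - (4 * k + 3) * (y ^ 2 * b)
        - 8 * (k + 1) * y ^ 2 - (4 * k + 5) * (y ^ 2 * a) - 6 * (k + 1) * y ^ 3 = 0 := by
      rw [← e1, hy]
      linear_combination a * h'
    linear_combination h2 + 4 * (k + 1) * y ^ 2 * ht
      + (4 * (k + 1) * 2 * y ^ 2 - 2 * (k + 1) * y) * hyz
  set u := y + z with hu
  have hv : (y - z) ^ 2 = u ^ 2 - 4 := by
    rw [hu]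
    linear_combination -4 * hyz
  have hab2 : (a - b) ^ 2 = (u ^ 2 - u - 4) ^ 2 - 4 := by
    rw [← ht]
    linear_combination -4 * hab
  have hprod : (u - 2) * (u + 2) * ((16 * (k + 1) ^ 2 - 1) * u ^ 2 - (16 * (k + 1) ^ 2 - 1 - 1) * u
      + (4 * (k + 1) ^ 2 + 3)) = 0 := by
    have := congrArg (· ^ 2) hd
    simp only [mul_pow, hv, hab2] at this
    linear_combination this
  rcases mul_eq_zero.mp hprod with h0 | h0
  · rcases mul_eq_zero.mp h0 with h0 | h0
    · have : (a + 1) ^ 2 = 0 := by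
        linear_combination a * ht - hab + a * (u + 1) * h0
      exact eq_neg_of_add_eq_zero_left (pow_eq_zero_iff two_ne_zero |>.mp this)
    · have : (a - 1) ^ 2 = 0 := by
        linear_combination a * ht - hab + a * (u - 3) * h0
      have ha1 : a = 1 := sub_eq_zero.mp (pow_eq_zero_iff two_ne_zero |>.mp this)
      subst ha1
      norm_num at h
  · have hk : 1 ≤ ((k : ℤ) + 1) ^ 2 := one_le_pow₀ (by omega)
    refine absurd ?_ (quadratic_ne_zero_of_isIntegral hui
      (A := 16 * (k + 1) ^ 2 - 1) (C := 4 * (k + 1) ^ 2 + 3) ?_ ?_)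
    · push_cast
      exact h0
    · linarith
    · nlinarith

/-- for `q ≥ 1`, `(1+X)²` divides `Qq` in `ℤ[X]`, `(1+X)³` does not, and the
quotient `Qq/(1+X)²` has no repeated complex roots. -/
theorem stmt7 (q : ℕ) (hq : 1 ≤ q) :
    ∃ r : Polynomial ℤ, Qq q = (1 + X) ^ 2 * r ∧
      ¬ ((1 + X) ^ 3 ∣ Qq q) ∧
      (∀ a : ℂ, (r.map (Int.castRingHom ℂ)).rootMultiplicity a ≤ 1) := by
  obtain ⟨k, rfl⟩ := Nat.exists_eq_add_of_le' hq
  obtain ⟨r, hr⟩ := sq_one_add_X_dvd_of_eval (eval_neg_one_Qq_succ k)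
    (eval_neg_one_derivative_Qq_succ k)
  have hndvd := not_one_add_X_pow_three_dvd_Qq_succ k
  refine ⟨r, hr, hndvd, fun a => ?_⟩
  by_contra! hlt
  obtain ⟨s, hs⟩ := (pow_dvd_pow _ hlt).trans (pow_rootMultiplicity_dvd _ a)
  have hra : aeval a r = 0 := by
    rw [← eval_map_algebraMap]
    change eval a (r.map (Int.castRingHom ℂ)) = 0
    simp [hs]
  have hra' : aeval a (derivative r) = 0 := by
    rw [← eval_map_algebraMap, ← derivative_map]
    change eval a (derivative (r.map (Int.castRingHom ℂ))) = 0
    simp [hs, derivative_mul, derivative_pow]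
  have ha : a = -1 := eq_neg_one_of_aeval_Qq_succ (k := k) (by simp [hr, hra])
    (by simp [hr, derivative_mul, hra, hra'])
  have hroot : r.IsRoot (-1) := by
    have : ((r.eval (-1) : ℤ) : ℂ) = 0 := by
      rw [← hra, ha]
      simpa using (aeval_algebraMap_apply_eq_algebraMap_eval (A := ℂ) (-1 : ℤ) r).symm
    exact_mod_cast this
  obtain ⟨t, rfl⟩ := dvd_iff_isRoot.mpr hroot
  refine hndvd ⟨t, hr.trans ?_⟩
  simp only [map_neg, map_one]
  ring
end

section
/- Let p ≥ 5 be an integer and a ∈ ℂ with a ∉ {0, 1, -1, √-1, -√-1}. If Q_p(a) = 0 and Q_p'(a) = 0, then p² - 16 + (16 - 2p²)a² - (36 + p²)a⁴ + (16 - 2p²)a⁶ + (p² - 16)a⁸ = 0. -/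
open Polynomial

/-- for `p ≥ 5` and `a ∈ ℂ \ {0, 1, -1, √-1, -√-1}`, if `Q_p(a) = 0` and
`Q_p'(a) = 0` then `p²-16 + (16-2p²)a² - (36+p²)a⁴ + (16-2p²)a⁶ + (p²-16)a⁸ = 0`. -/
theorem stmt9 (p : ℕ) (hp : 5 ≤ p) (a : ℂ)
    (ha0 : a ≠ 0) (ha1 : a ≠ 1) (ha1' : a ≠ -1) (haI : a ≠ Complex.I) (haI' : a ≠ -Complex.I)
    (hQ : Polynomial.aeval a (Qp p) = 0)
    (hQ' : Polynomial.aeval a (derivative (Qp p)) = 0) :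
    (p : ℂ) ^ 2 - 16 + (16 - 2 * (p : ℂ) ^ 2) * a ^ 2 - (36 + (p : ℂ) ^ 2) * a ^ 4 +
      (16 - 2 * (p : ℂ) ^ 2) * a ^ 6 + ((p : ℂ) ^ 2 - 16) * a ^ 8 = 0 := by
  obtain ⟨k, rfl⟩ : ∃ k, p = k + 5 := ⟨p - 5, by omega⟩
  have e4 : k + 5 - 4 = k + 1 := by omega
  have e2 : k + 5 - 2 = k + 3 := by omega
  simp only [Qp, e4, e2, derivative_one, derivative_mul,
    derivative_X_pow, derivative_ofNat, map_add, map_sub, map_mul, map_pow, map_one, map_zero,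
    map_natCast, map_ofNat, aeval_X] at hQ hQ'
  have e0 : 2 * (k + 5) - 1 = 2 * k + 9 := by omega
  simp only [Nat.add_one_sub_one, e0] at hQ'
  push_cast at hQ' ⊢
  set z : ℂ := a ^ (k + 1) with hz
  have hz0 : z ≠ 0 := pow_ne_zero _ ha0
  have hval : 1 - z * (1 - a ^ 2 - 2 * a ^ 4 - a ^ 6 + a ^ 8) + z ^ 2 * a ^ 8 = 0 := by
    rw [hz]; linear_combination hQ
  have hder : 2 * ((k : ℂ) + 5) * z * a ^ 8
      - ((k : ℂ) + 5) * (1 - a ^ 2 - 2 * a ^ 4 - a ^ 6 + a ^ 8)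
      + (4 - 2 * a ^ 2 + 2 * a ^ 6 - 4 * a ^ 8) = 0 := by
    refine (mul_eq_zero.mp ?_).resolve_left hz0
    rw [hz]; linear_combination a * hQ'
  have hsq : (a ^ 4 - 1) ^ 2 ≠ 0 := by
    have hfac : a ^ 4 - 1 = (a - 1) * (a - -1) * ((a - Complex.I) * (a - -Complex.I)) := by
      linear_combination (a ^ 2 - 1) * Complex.I_sq
    rw [hfac]
    exact pow_ne_zero _ (mul_ne_zero (mul_ne_zero (sub_ne_zero.mpr ha1) (sub_ne_zero.mpr ha1'))
      (mul_ne_zero (sub_ne_zero.mpr haI) (sub_ne_zero.mpr haI')))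
  refine (mul_eq_zero.mp ?_).resolve_left hsq
  linear_combination (-4 * a ^ 8 * ((k : ℂ) + 5) ^ 2) * hval +
    (2 * ((k : ℂ) + 5) * z * a ^ 8 - ((k : ℂ) + 5) * (1 - a ^ 2 - 2 * a ^ 4 - a ^ 6 + a ^ 8)
      - (4 - 2 * a ^ 2 + 2 * a ^ 6 - 4 * a ^ 8)) * hder
end

section
/- Let q ≥ 1 be an integer and a ∈ ℂ with a ∉ {1, -1}. If Qq(a) = 0 and Qq'(a) = 0, then, setting b = a^(2q), one has (1-b)²(1+b)²(-1 + 2b + b² + 2b³ - b⁴ + 16q² - 16q²b + 36q²b² - 16q²b³ + 16q²b⁴) = 0. -/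
open Polynomial

/-- for `q ≥ 1` and `a ∈ ℂ \ {1, -1}`, if `Qq(a) = 0` and `Qq'(a) = 0` then,
with `b = a^(2q)`,
`(1-b)²(1+b)²(-1 + 2b + b² + 2b³ - b⁴ + 16q² - 16q²b + 36q²b² - 16q²b³ + 16q²b⁴) = 0`. -/
theorem stmt10 (q : ℕ) (hq : 1 ≤ q) (a : ℂ) (ha1 : a ≠ 1) (ha1' : a ≠ -1)
    (hQ : Polynomial.aeval a (Qq q) = 0)
    (hQ' : Polynomial.aeval a (derivative (Qq q)) = 0) :
    ∀ b : ℂ, b = a ^ (2 * q) →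
      (1 - b) ^ 2 * (1 + b) ^ 2 *
        (-1 + 2 * b + b ^ 2 + 2 * b ^ 3 - b ^ 4 + 16 * (q : ℂ) ^ 2 - 16 * (q : ℂ) ^ 2 * b +
          36 * (q : ℂ) ^ 2 * b ^ 2 - 16 * (q : ℂ) ^ 2 * b ^ 3 + 16 * (q : ℂ) ^ 2 * b ^ 4) = 0 := by
  rintro b rfl
  obtain ⟨k, rfl⟩ : ∃ k, q = k + 1 := ⟨q - 1, by omega⟩
  have e1 : 4 * (k + 1) - 1 = 4 * k + 3 := by omega
  have e2 : 2 * (k + 1) - 1 = 2 * k + 1 := by omega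
  have e3 : 6 * (k + 1) - 1 = 6 * k + 5 := by omega
  have e4 : 8 * (k + 1) - 1 = 8 * k + 7 := by omega
  have e5 : 4 * k + 3 - 1 = 4 * k + 2 := by omega
  have ha : a ≠ 0 := by
    rintro rfl
    simp [Qq, e1] at hQ
  have h2 : derivative (2 : ℤ[X]) = 0 := derivative_ofNat 2
  simp only [Qq, e1, map_add, map_sub, map_mul, map_pow, map_one, map_ofNat, aeval_X] at hQ
  simp only [Qq, e1, e2, e3, e4, e5, h2, derivative_mul,
    derivative_one, derivative_X_pow, map_add, map_sub, map_mul, map_pow, map_zero, map_ofNat,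
    map_natCast, aeval_X, Nat.add_sub_cancel] at hQ'
  push_cast at hQ' ⊢
  set b : ℂ := a ^ (2 * (k + 1)) with hb
  have h₁ : a * (1 - b - 2 * b ^ 2 - b ^ 3 + b ^ 4) = b ^ 2 * (1 + a ^ 2) := by
    rw [hb]
    linear_combination a * hQ
  have h₂ : ((k : ℂ) + 1) * a * (2 * (b ^ 2 - 1) * (2 * b ^ 2 - b + 2)) = b ^ 2 * (a ^ 2 - 1) := by
    rw [hb]
    linear_combination a ^ 2 * hQ' - 4 * ((k : ℂ) + 1) * a * hQ
  clear_value b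
  refine (mul_eq_zero.1 ?_).resolve_left (pow_ne_zero 2 ha)
  generalize (k : ℂ) + 1 = q at *
  linear_combination
    (q * a * (2 * (b ^ 2 - 1) * (2 * b ^ 2 - b + 2)) + b ^ 2 * (a ^ 2 - 1)) * h₂ -
      (a * (1 - b - 2 * b ^ 2 - b ^ 3 + b ^ 4) + b ^ 2 * (1 + a ^ 2)) * h₁
end

section
/- Let p ≥ 5 be an integer and a ∈ ℂ with Q_p(a) = 0 and a ∉ {0, 1, -1, √-1, -√-1}. Then τ_p(a⁻¹) = τ_p(a). -/
open Polynomial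

/-- The adjoint Reidemeister torsion `τ_p(a)` of `S³_{p/1}(4₁)` at the representation
parametrized by `a` (for `a ∉ {1, -1, √-1, -√-1}`). -/
noncomputable def tau (p : ℕ) (a : ℂ) : ℂ :=
  -((4 - (p : ℂ) + ((p : ℂ) - 2) * a ^ 2 + 2 * (p : ℂ) * a ^ 4 + ((p : ℂ) + 2) * a ^ 6 -
      ((p : ℂ) + 4) * a ^ 8 + 2 * (p : ℂ) * a ^ (p + 4)) /
    (2 * (a ^ 2 - 1) ^ 3 * (1 + a ^ 2)))

/-- for `p ≥ 5` and a root `a` of `Q_p` with `a ∉ {0, 1, -1, √-1, -√-1}`,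
`τ_p(a⁻¹) = τ_p(a)`. -/
theorem stmt11 (p : ℕ) (hp : 5 ≤ p) (a : ℂ)
    (ha0 : a ≠ 0) (ha1 : a ≠ 1) (ha1' : a ≠ -1) (haI : a ≠ Complex.I) (haI' : a ≠ -Complex.I)
    (hQ : Polynomial.aeval a (Qp p) = 0) :
    tau p a⁻¹ = tau p a := by
  obtain ⟨k, rfl⟩ : ∃ k, p = k + 4 := ⟨p - 4, by omega⟩
  have hQ' : 1 - a ^ k + a ^ k * a ^ 2 + 2 * (a ^ k * a ^ 4) + a ^ k * a ^ 6 - a ^ k * a ^ 8 +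
      (a ^ k) ^ 2 * a ^ 8 = 0 := by
    have h2 : k + 4 - 2 = k + 2 := by omega
    simp only [Qp, Nat.add_sub_cancel, h2, map_add, map_sub, map_mul, map_pow, map_one,
      map_ofNat, aeval_X] at hQ
    linear_combination hQ
  have hb : a ^ k ≠ 0 := pow_ne_zero _ ha0
  have hpow : a ^ (k + 4 + 4) = a ^ k * a ^ 8 := by ring
  unfold tau
  rw [inv_pow a (k + 4 + 4), hpow]
  generalize a ^ k = b at hQ' hb
  generalize ((k + 4 : ℕ) : ℂ) = q
  have hden : 2 * (a⁻¹ ^ 2 - 1) ^ 3 * (1 + a⁻¹ ^ 2) =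
      (2 * (a ^ 2 - 1) ^ 3 * (1 + a ^ 2)) * (-(a ^ 8)⁻¹) := by
    field_simp
    ring
  have hnum : 4 - q + (q - 2) * a⁻¹ ^ 2 + 2 * q * a⁻¹ ^ 4 + (q + 2) * a⁻¹ ^ 6 -
        (q + 4) * a⁻¹ ^ 8 + 2 * q * (b * a ^ 8)⁻¹ =
      (4 - q + (q - 2) * a ^ 2 + 2 * q * a ^ 4 + (q + 2) * a ^ 6 -
        (q + 4) * a ^ 8 + 2 * q * (b * a ^ 8)) * (-(a ^ 8)⁻¹) := by
    field_simp
    linear_combination 2 * q * hQ'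
  have hunit : -(a ^ 8)⁻¹ ≠ 0 := neg_ne_zero.mpr (inv_ne_zero (pow_ne_zero _ ha0))
  rw [hnum, hden, mul_div_mul_right _ _ hunit]
end

section
/- Let p ≥ 5 be an integer not divisible by 4, and let R be the set of distinct complex roots of Q_p that are different from -1. Then Q_p'(a) ≠ 0 for every a ∈ R, and ∑_{a ∈ R} 2(1-a²)³(1+a²)·a^(p-5) / Q_p'(a) = 0. (Equivalently, the sum of the reciprocals of the adjoint torsions τ_p(a) over R vanishes.) -/
open Polynomial

/-- The set of distinct complex roots of `Q_p`. -/
noncomputable def QpRoots (p : ℕ) : Finset ℂ :=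
  ((Qp p).map (Int.castRingHom ℂ)).roots.toFinset

namespace Polynomial

/-- Euler's identity: for `f` of degree at most `#s - 2`, the sum over the roots of the nodal
polynomial of `f` divided by its derivative vanishes. -/
lemma sum_eval_div_derivative_nodal_eq_zero {K : Type*} [Field K] [DecidableEq K] (s : Finset K)
    (f : K[X]) (hf : f.natDegree + 1 < s.card) :
    ∑ a ∈ s, f.eval a / (derivative (Lagrange.nodal s id)).eval a = 0 := by
  have hdeg : f.degree < s.card :=
    lt_of_le_of_lt degree_le_natDegree (by exact_mod_cast (by omega : f.natDegree < s.card))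
  have h := Lagrange.coeff_eq_sum (s := s) (v := id) Function.injective_id.injOn hdeg
  rw [coeff_eq_zero_of_natDegree_lt (by omega)] at h
  rw [h]
  refine Finset.sum_congr rfl fun a ha => ?_
  have h' := Lagrange.eval_nodal_derivative_eval_node_eq (v := (id : K → K)) ha
  rw [Lagrange.eval_nodal] at h'
  simp only [id_eq] at h' ⊢
  rw [h']

/-- A monic polynomial all of whose roots other than `c` are simple is a power of `X - c` times
the nodal polynomial of its other roots. -/
lemma Splits.eq_pow_mul_nodal {K : Type*} [Field K] [DecidableEq K] [CharZero K]
    {P : K[X]} (hs : P.Splits) (hm : P.Monic) (c : K)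
    (h : ∀ a, P.IsRoot a → a ≠ c → ¬ (derivative P).IsRoot a) :
    P = (X - C c) ^ P.rootMultiplicity c * Lagrange.nodal (P.roots.toFinset \ {c}) id := by
  have hroots : P.roots =
      Multiset.replicate (P.rootMultiplicity c) c + (P.roots.toFinset \ {c}).val := by
    ext b
    rw [Multiset.count_add, Multiset.count_replicate, count_roots]
    by_cases hb : b = c
    · subst hb
      rw [if_pos rfl, Multiset.count_eq_zero_of_notMem (by rw [Finset.mem_val]; simp), add_zero]
    · rw [if_neg (Ne.symm hb), zero_add, Multiset.count_eq_of_nodup (Finset.nodup _)]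
      by_cases hr : P.IsRoot b
      · have h1 : ¬ 1 < P.rootMultiplicity b := fun h1 =>
          h b hr hb ((one_lt_rootMultiplicity_iff_isRoot hm.ne_zero).1 h1).2
        have h0 := (rootMultiplicity_pos hm.ne_zero).2 hr
        rw [if_pos (by rw [Finset.mem_val]; simpa [hm.ne_zero, hb] using hr)]
        omega
      · rw [if_neg (by rw [Finset.mem_val]; simp_all), rootMultiplicity_eq_zero hr]
  conv_lhs => rw [hs.eq_prod_roots_of_monic hm, hroots]
  simp [Lagrange.nodal, Finset.prod]

end Polynomial

/-- An algebraic integer cannot satisfy the quadratic equation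
`p² (u - 3) (u + 1) = (4 u - 2)²`. -/
lemma IsIntegral.sq_mul_sub_mul_add_ne {u : ℂ} (hu : IsIntegral ℤ u) (p : ℕ) (hp : 5 ≤ p) :
    (p : ℂ) ^ 2 * (u - 3) * (u + 1) ≠ (4 * u - 2) ^ 2 := by
  intro h
  have hp' : (5 : ℤ) ≤ p := by exact_mod_cast hp
  obtain ⟨A, hA⟩ : ∃ A : ℤ, A = (p : ℤ) ^ 2 - 16 := ⟨_, rfl⟩
  obtain ⟨B, hB⟩ : ∃ B : ℤ, B = 16 - 2 * (p : ℤ) ^ 2 := ⟨_, rfl⟩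
  obtain ⟨D, hD⟩ : ∃ D : ℤ, D = -4 - 3 * (p : ℤ) ^ 2 := ⟨_, rfl⟩
  set q : ℤ[X] := C A * X ^ 2 + C B * X + C D with hq
  have hlead : A ≠ 0 := by
    rw [hA]
    nlinarith
  have hdeg : q.natDegree = 2 := natDegree_quadratic hlead
  have hroot : aeval u q = 0 := by
    simp only [hq, map_add, map_mul, map_pow, aeval_X, aeval_C, algebraMap_int_eq,
      Int.coe_castRingHom, hA, hB, hD]
    push_cast
    linear_combination h
  obtain ⟨r, hr⟩ := minpoly.isIntegrallyClosed_dvd hu hroot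
  have hm := minpoly.monic hu
  have hpos := minpoly.natDegree_pos hu
  generalize minpoly ℤ u = m at hr hm hpos
  have hr0 : r ≠ 0 := by
    rintro rfl
    rw [hr] at hdeg
    simp at hdeg
  have hadd : m.natDegree + r.natDegree = 2 := by
    rw [← hdeg, hr, natDegree_mul hm.ne_zero hr0]
  rcases (by omega : m.natDegree = 1 ∨ m.natDegree = 2) with h1 | h2
  · obtain ⟨x, hx⟩ : ∃ x : ℤ, m.eval x = 0 := by
      refine ⟨-m.coeff 0, ?_⟩
      rw [hm.eq_X_add_C h1]
      simp
    have hqx : q.eval x = 0 := by rw [hr, eval_mul, hx, zero_mul]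
    simp only [hq, eval_add, eval_mul, eval_C, eval_pow, eval_X] at hqx
    have key : (p : ℤ) ^ 2 * ((x - 3) * (x + 1)) = (4 * x - 2) ^ 2 := by
      rw [hA, hB, hD] at hqx
      linear_combination hqx
    obtain ⟨k, hk⟩ : (p : ℤ) ∣ 4 * x - 2 :=
      (Int.pow_dvd_pow_iff two_ne_zero).1 ⟨_, key.symm⟩
    have hsq : (x - 3) * (x + 1) = k ^ 2 := by
      have : (p : ℤ) ^ 2 ≠ 0 := by positivity
      apply mul_left_cancel₀ this
      rw [key, hk]
      ring
    have hk0 : k ≠ 0 := by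
      rintro rfl
      omega
    have hk1 : 1 ≤ |k| := Int.one_le_abs hk0
    have hy : |x - 1| ^ 2 = |k| ^ 2 + 4 := by
      rw [sq_abs, sq_abs]
      linear_combination hsq
    have hy0 := abs_nonneg (x - 1)
    have hlt : |k| < |x - 1| := by nlinarith
    have hlt2 : |x - 1| < |k| + 2 := by nlinarith
    have heq : |x - 1| = |k| + 1 := by omega
    rw [heq] at hy
    have : 2 * |k| = 3 := by linear_combination hy
    omega
  · have hrc : r = C (r.coeff 0) := eq_C_of_natDegree_eq_zero (by omega)
    rw [hrc] at hr
    have c2 : q.coeff 2 = m.coeff 2 * r.coeff 0 := by rw [hr, coeff_mul_C]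
    have c1 : q.coeff 1 = m.coeff 1 * r.coeff 0 := by rw [hr, coeff_mul_C]
    have hm2 : m.coeff 2 = 1 := by
      rw [← h2]
      exact hm
    rw [hm2] at c2
    simp only [hq, coeff_add, coeff_C_mul, coeff_X_pow, coeff_X, coeff_C] at c2 c1
    norm_num at c2 c1
    rw [← c2, hA, hB] at c1
    have hdvd : (p : ℤ) ^ 2 - 16 ∣ 16 := by
      refine ⟨-m.coeff 1 - 2, ?_⟩
      linear_combination -c1
    have hle := Int.le_of_dvd (by norm_num) hdvd
    have hp5 : (p : ℤ) = 5 := by nlinarith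
    rw [hp5] at hdvd
    norm_num at hdvd

lemma Qp_add_five (n : ℕ) : Qp (n + 5) = 1 - X ^ (n + 1) + X ^ (n + 3) + 2 * X ^ (n + 5) +
    X ^ (n + 7) - X ^ (n + 9) + X ^ (2 * n + 10) := rfl

lemma Qp_add_five_coeff (n : ℕ) : (Qp (n + 5)).coeff (2 * n + 10) = 1 := by
  rw [Qp_add_five]
  have h2 : (2 : ℤ[X]) = C 2 := rfl
  simp only [h2, coeff_add, coeff_sub, coeff_one, coeff_C_mul, coeff_X_pow]
  split_ifs <;> first | contradiction | omega

lemma Qp_add_five_natDegree (n : ℕ) : (Qp (n + 5)).natDegree = 2 * n + 10 := by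
  refine natDegree_eq_of_le_of_coeff_ne_zero ?_ (by rw [Qp_add_five_coeff]; exact one_ne_zero)
  rw [Qp_add_five]
  compute_degree
  rw [max_eq_right (by omega)]

lemma Qp_add_five_monic (n : ℕ) : (Qp (n + 5)).Monic := by
  rw [Monic, leadingCoeff, Qp_add_five_natDegree, Qp_add_five_coeff]

lemma aeval_Qp_add_five (n : ℕ) (a : ℂ) : aeval a (Qp (n + 5)) =
    1 + a ^ n * (-a + a ^ 3 + 2 * a ^ 5 + a ^ 7 - a ^ 9) + a ^ 10 * (a ^ n) ^ 2 := by
  rw [Qp_add_five]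
  simp [map_ofNat]
  ring

lemma aeval_derivative_Qp_add_five (n : ℕ) (a : ℂ) : aeval a (derivative (Qp (n + 5))) =
    a ^ n * (-(n + 1) + (n + 3) * a ^ 2 + 2 * (n + 5) * a ^ 4 + (n + 7) * a ^ 6 -
      (n + 9) * a ^ 8 + (2 * n + 10) * a ^ 9 * a ^ n) := by
  rw [Qp_add_five]
  simp [map_ofNat]
  ring

/-- Away from `-1`, the roots of `Q_p` are simple if `4 ∤ p`. -/
lemma aeval_derivative_Qp_ne_zero (n : ℕ) (h4 : ¬ 4 ∣ n + 5) (a : ℂ)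
    (ha : aeval a (Qp (n + 5)) = 0) (ha1 : a ≠ -1) :
    aeval a (derivative (Qp (n + 5))) ≠ 0 := by
  intro hd
  have hint : IsIntegral ℤ a := ⟨_, Qp_add_five_monic n, ha⟩
  rw [aeval_Qp_add_five] at ha
  rw [aeval_derivative_Qp_add_five] at hd
  have ha0 : a ≠ 0 := by
    rintro rfl
    simp at ha
  have hd' := (mul_eq_zero.1 hd).resolve_left (pow_ne_zero n ha0)
  have hint' : IsIntegral ℤ a⁻¹ := by
    refine ⟨_, Qp_add_five_monic n, ?_⟩
    change aeval a⁻¹ (Qp (n + 5)) = 0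
    rw [aeval_Qp_add_five]
    have hT : a ^ n ≠ 0 := pow_ne_zero n ha0
    rw [inv_pow]
    field_simp
    linear_combination ha
  have hprod : (a ^ 4 + 1 - 2 * a ^ 2) * ((a ^ 4 + 1 + 2 * a ^ 2) *
      (((n : ℂ) + 5) ^ 2 * (a ^ 4 + 1 - 3 * a ^ 2) * (a ^ 4 + 1 + a ^ 2) -
        (4 * (a ^ 4 + 1) - 2 * a ^ 2) ^ 2)) = 0 := by
    linear_combination (-4 * a ^ 8 * ((n : ℂ) + 5) ^ 2) * ha +
      (2 * ((n : ℂ) + 5) * a ^ 9 * a ^ n +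
        ((n : ℂ) + 5) * (-1 + a ^ 2 + 2 * a ^ 4 + a ^ 6 - a ^ 8) -
        (4 - 2 * a ^ 2 + 2 * a ^ 6 - 4 * a ^ 8)) * hd'
  rcases mul_eq_zero.1 hprod with h | h
  · have h1 : (a - 1) * (a + 1) = 0 := by
      apply pow_eq_zero_iff (two_ne_zero) |>.1
      linear_combination h
    rcases mul_eq_zero.1 h1 with h | h
    · obtain rfl : a = 1 := by linear_combination h
      norm_num at ha
    · exact ha1 (by linear_combination h)
  rcases mul_eq_zero.1 h with h | h
  · have h2 : a ^ 2 = -1 := by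
      have : a ^ 2 + 1 = 0 := by
        apply pow_eq_zero_iff (two_ne_zero) |>.1
        linear_combination h
      linear_combination this
    have e4 : a ^ 4 = 1 := by linear_combination (a ^ 2 - 1) * h2
    have hT : a ^ n = -a := by
      have : a ^ n + a = 0 := by
        apply pow_eq_zero_iff (two_ne_zero) |>.1
        have e3 : a ^ 3 = -a := by linear_combination a * h2
        have e5 : a ^ 5 = a := by linear_combination a * e4
        have e7 : a ^ 7 = -a := by linear_combination a ^ 3 * e4 + e3
        have e9 : a ^ 9 = a := by linear_combination a ^ 5 * e4 + e5
        have e10 : a ^ 10 = -1 := by linear_combination (a ^ 6 + a ^ 2) * e4 + h2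
        rw [e3, e5, e7, e9, e10] at ha
        linear_combination -ha + h2
      linear_combination this
    have hne1 : a ≠ 1 := by
      rintro rfl
      norm_num at h2
    rw [← Nat.div_add_mod n 4, pow_add, pow_mul, e4, one_pow, one_mul] at hT
    have hlt := Nat.mod_lt n (by norm_num : 4 > 0)
    have hne3 : n % 4 ≠ 3 := by omega
    generalize n % 4 = j at hT hlt hne3
    interval_cases j
    · exact ha1 (by linear_combination hT)
    · exact ha0 (by linear_combination hT / 2)
    · exact hne1 (by linear_combination hT - h2)
    · exact hne3 rfl
  · have hu : IsIntegral ℤ (a ^ 2 + a⁻¹ ^ 2) := (hint.pow 2).add (hint'.pow 2)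
    refine hu.sq_mul_sub_mul_add_ne (n + 5) (by omega) ?_
    push_cast
    field_simp
    linear_combination h

/-- The multiplicity of `-1` as a root of `Q_p` is at most two. -/
lemma rootMultiplicity_neg_one_Qp_le (n : ℕ) :
    ((Qp (n + 5)).map (Int.castRingHom ℂ)).rootMultiplicity (-1) ≤ 2 := by
  by_contra! hlt
  rw [lt_rootMultiplicity_iff_isRoot_iterate_derivative
    ((Qp_add_five_monic n).map _).ne_zero] at hlt
  have h0 := hlt 0 (by norm_num)
  have h2 := hlt 2 le_rfl
  rw [Qp_add_five] at h0 h2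
  rcases n.even_or_odd' with ⟨m, rfl | rfl⟩
  · rcases m with _ | m
    · simp at h2
      norm_num at h2
    · simp [mul_add] at h2
      ring_nf at h2
      rw [Even.neg_one_pow ⟨m, by ring⟩, Even.neg_one_pow ⟨2 * m, by ring⟩] at h2
      have h3 : ((8 * m ^ 2 + 56 * m + 122 : ℕ) : ℂ) = 0 := by
        push_cast
        linear_combination h2
      rw [Nat.cast_eq_zero] at h3
      omega
  · simp [pow_succ, pow_mul] at h0
    norm_num at h0

/-- for `p ≥ 5` not divisible by `4`, with `R` the set of distinct complex roots
of `Q_p` different from `-1`, one has `Q_p'(a) ≠ 0` for all `a ∈ R` and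
`∑_{a ∈ R} 2(1-a²)³(1+a²)a^(p-5) / Q_p'(a) = 0`. -/
theorem stmt12 (p : ℕ) (hp : 5 ≤ p) (hp4 : ¬ (4 ∣ p)) :
    (∀ a ∈ QpRoots p \ {-1}, Polynomial.aeval a (derivative (Qp p)) ≠ 0) ∧
    ∑ a ∈ QpRoots p \ {-1},
        2 * (1 - a ^ 2) ^ 3 * (1 + a ^ 2) * a ^ (p - 5) /
          Polynomial.aeval a (derivative (Qp p)) = 0 := by
  obtain ⟨n, rfl⟩ : ∃ n, p = n + 5 := ⟨p - 5, by omega⟩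
  set P : ℂ[X] := (Qp (n + 5)).map (Int.castRingHom ℂ) with hP
  have hm : P.Monic := (Qp_add_five_monic n).map _
  have heval (a : ℂ) (q : ℤ[X]) : aeval a q = (q.map (Int.castRingHom ℂ)).eval a :=
    (eval_map_algebraMap q a).symm
  have hsimple (a : ℂ) (ha : P.IsRoot a) (ha1 : a ≠ -1) :
      aeval a (derivative (Qp (n + 5))) ≠ 0 :=
    aeval_derivative_Qp_ne_zero n hp4 a (by rw [heval]; exact ha) ha1
  have hmem (a : ℂ) (ha : a ∈ QpRoots (n + 5) \ {-1}) : P.IsRoot a ∧ a ≠ -1 := by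
    simp only [QpRoots, Finset.mem_sdiff, Multiset.mem_toFinset, Finset.mem_singleton] at ha
    exact ⟨isRoot_of_mem_roots ha.1, ha.2⟩
  refine ⟨fun a ha => hsimple a (hmem a ha).1 (hmem a ha).2, ?_⟩
  have hfac := (IsAlgClosed.splits P).eq_pow_mul_nodal hm (-1) fun a ha ha1 => by
    rw [hP, derivative_map, IsRoot, ← heval]
    exact hsimple a ha ha1
  have hk : P.rootMultiplicity (-1) ≤ 2 := rootMultiplicity_neg_one_Qp_le n
  change P = _ * Lagrange.nodal (QpRoots (n + 5) \ {-1}) id at hfac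
  generalize P.rootMultiplicity (-1) = k at hfac hk
  generalize QpRoots (n + 5) \ {-1} = R at hfac hmem
  have hcard : 2 * n + 10 = k + R.card := by
    rw [← Qp_add_five_natDegree n, ← (Qp_add_five_monic n).natDegree_map (Int.castRingHom ℂ),
      ← hP, hfac, Monic.natDegree_mul ((monic_X_sub_C _).pow k) Lagrange.nodal_monic,
      Lagrange.natDegree_nodal, natDegree_pow, natDegree_X_sub_C, mul_one]
  set f : ℂ[X] := (X + 1) ^ (3 - k) * (2 * (1 - X) ^ 3 * (1 + X ^ 2) * X ^ n) with hf
  have hfdeg : f.natDegree ≤ (3 - k) + (n + 5) := by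
    have h2 : (2 : ℂ[X]) = C 2 := rfl
    rw [hf, h2]
    compute_degree
    omega
  rw [← sum_eval_div_derivative_nodal_eq_zero R f (by omega)]
  refine Finset.sum_congr rfl fun a ha => ?_
  have hnod : (Lagrange.nodal R id).eval a = 0 := Lagrange.eval_nodal_at_node (v := id) ha
  have hder : aeval a (derivative (Qp (n + 5))) =
      (a + 1) ^ k * (derivative (Lagrange.nodal R id)).eval a := by
    rw [heval, ← derivative_map, ← hP, hfac, derivative_mul, eval_add, eval_mul, hnod]
    simp
  have ha1 : a + 1 ≠ 0 := fun h => (hmem a ha).2 (by linear_combination h)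
  have hnum : 2 * (1 - a ^ 2) ^ 3 * (1 + a ^ 2) * a ^ (n + 5 - 5) = (a + 1) ^ k * f.eval a := by
    simp only [hf, eval_mul, eval_pow, eval_add, eval_sub, eval_X, eval_one, eval_ofNat,
      Nat.add_sub_cancel]
    rw [← mul_assoc ((a + 1) ^ k), ← pow_add, Nat.add_sub_of_le (by omega)]
    ring
  rw [hder, hnum, mul_div_mul_left _ _ (pow_ne_zero k ha1)]
end

section
/- Let m ≥ 3 be an odd integer, set p = 2m, and let n ≥ 2 be an integer. Then no complex root of Q_{2m} lies in {1, -1, √-1, -√-1}, and the sum ∑_{a} (8·τ_{2m}(a))^n, taken over the set of distinct complex roots a of Q_{2m}, is an integer (i.e., it equals z for some z ∈ ℤ). -/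
open Polynomial

/-- The sum of the values of an integer polynomial over the distinct complex roots of an integer
polynomial is rational. -/
theorem exists_rat_eq_sum_aeval_roots (P g : ℤ[X]) :
    ∃ q : ℚ, ∑ a ∈ (P.map (Int.castRingHom ℂ)).roots.toFinset, aeval a g = (q : ℂ) := by
  classical
  set PQ : ℚ[X] := P.map (Int.castRingHom ℚ) with hPQ
  let K := PQ.SplittingField
  have hsplit : (PQ.map (algebraMap ℚ K)).Splits := SplittingField.splits PQ
  let f : K →ₐ[ℚ] ℂ := SplittingField.lift PQ (IsAlgClosed.splits _)
  have : IsSplittingField ℚ K PQ := IsSplittingField.splittingField PQ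
  have : Normal ℚ K := Normal.of_isSplittingField PQ
  have : IsGalois ℚ K := ⟨⟩
  set s : K := ∑ x ∈ (PQ.map (algebraMap ℚ K)).roots.toFinset, aeval x g with hs
  have hfix : ∀ σ : K ≃ₐ[ℚ] K, σ s = s := by
    intro σ
    have hroots : (PQ.map (algebraMap ℚ K)).roots.toFinset.image σ =
        (PQ.map (algebraMap ℚ K)).roots.toFinset := by
      have h := hsplit.roots_map (σ : K →+* K)
      rw [Polynomial.map_map, ← AlgEquiv.toAlgHom_toRingHom, AlgHom.comp_algebraMap] at h
      conv_rhs => rw [h]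
      rw [Multiset.toFinset_map]
      rfl
    conv_rhs => rw [hs, ← hroots, Finset.sum_image σ.injective.injOn]
    rw [hs, map_sum]
    refine Finset.sum_congr rfl fun x _ => ?_
    exact (aeval_algHom_apply (σ.toAlgHom.restrictScalars ℤ) x g).symm
  obtain ⟨q, hq⟩ := (IsGalois.mem_range_algebraMap_iff_fixed s).2 hfix
  refine ⟨q, ?_⟩
  have hP : P.map (Int.castRingHom ℂ) = PQ.map (algebraMap ℚ ℂ) := by
    rw [hPQ, Polynomial.map_map]
    exact congrArg (P.map ·) (RingHom.ext_int _ _)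
  have hroots : (P.map (Int.castRingHom ℂ)).roots.toFinset =
      (PQ.map (algebraMap ℚ K)).roots.toFinset.image f := by
    have h := hsplit.roots_map (f : K →+* ℂ)
    rw [Polynomial.map_map, AlgHom.comp_algebraMap] at h
    rw [hP, h, Multiset.toFinset_map]
    rfl
  have hinj : Function.Injective f := (f : K →+* ℂ).injective
  rw [hroots, Finset.sum_image hinj.injOn]
  have hfs : f s = (q : ℂ) := by
    rw [← hq, AlgHom.commutes]
    simp
  rw [← hfs, hs, map_sum]
  exact Finset.sum_congr rfl fun x _ => aeval_algHom_apply (f.restrictScalars ℤ) x g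

/-- The sum of the values of an integer polynomial over the distinct complex roots of a monic
integer polynomial is an integer. -/
theorem exists_int_eq_sum_aeval_roots {P : ℤ[X]} (hP : P.Monic) (g : ℤ[X]) :
    ∃ z : ℤ, ∑ a ∈ (P.map (Int.castRingHom ℂ)).roots.toFinset, aeval a g = (z : ℂ) := by
  obtain ⟨q, hq⟩ := exists_rat_eq_sum_aeval_roots P g
  have hint : IsIntegral ℤ (algebraMap ℚ ℂ q) := by
    rw [eq_ratCast, ← hq]
    refine IsIntegral.sum _ fun a ha => ?_
    have hroot : IsIntegral ℤ a := by
      refine ⟨P, hP, ?_⟩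
      have h := (mem_roots'.1 (Multiset.mem_toFinset.1 ha)).2
      rwa [IsRoot.def, eval_map] at h
    exact adjoin_le_integralClosure hroot (aeval_mem_adjoin_singleton ℤ a)
  rw [isIntegral_algebraMap_iff (algebraMap ℚ ℂ).injective] at hint
  obtain ⟨z, hz⟩ := IsIntegrallyClosed.isIntegral_iff.1 hint
  exact ⟨z, by rw [hq, ← hz]; simp⟩

theorem monic_Qp {p : ℕ} (hp : 5 ≤ p) : (Qp p).Monic := by
  have h : (1 - X ^ (p - 4) + X ^ (p - 2) + 2 * X ^ p + X ^ (p + 2) - X ^ (p + 4) :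
      ℤ[X]).natDegree ≤ p + 4 := by
    compute_degree
  have h' := (degree_le_of_natDegree_le h).trans_lt
    (show ((p + 4 : ℕ) : WithBot ℕ) < (2 * p : ℕ) by exact_mod_cast (by omega))
  rw [Qp, add_comm]
  exact monic_X_pow_add h'

theorem aeval_Qp_two_mul (k : ℕ) (a : ℂ) :
    aeval a (Qp (2 * (k + 3))) = 1 - (a ^ 2) ^ (k + 1) + (a ^ 2) ^ (k + 2) + 2 * (a ^ 2) ^ (k + 3) +
      (a ^ 2) ^ (k + 4) - (a ^ 2) ^ (k + 5) + (a ^ 2) ^ (2 * k + 6) := by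
  rw [Qp, show 2 * (k + 3) - 4 = 2 * (k + 1) by omega, show 2 * (k + 3) - 2 = 2 * (k + 2) by omega]
  simp only [map_add, map_sub, map_mul, map_pow, aeval_X, map_one, map_ofNat]
  ring

theorem sq_ne_of_aeval_Qp_eq_zero {m : ℕ} (hm : 3 ≤ m) (hodd : Odd m) {a : ℂ}
    (ha : aeval a (Qp (2 * m)) = 0) : a ^ 2 ≠ 1 ∧ a ^ 2 ≠ -1 := by
  obtain ⟨k, rfl⟩ := Nat.exists_eq_add_of_le' hm
  rw [aeval_Qp_two_mul] at ha
  have hk : Even k := by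
    rcases Nat.even_or_odd k with h | h
    · exact h
    · exact absurd hodd (by simpa using h.add_odd (by decide : Odd 3))
  constructor <;> intro h <;> rw [h] at ha
  · norm_num at ha
  · simp only [pow_add, pow_mul, hk.neg_one_pow] at ha
    norm_num at ha

/-- An integer polynomial taking the value `8 * tau` at the roots of `Qp (2 * (k + 3))`. -/
noncomputable def eightTauPoly (k : ℕ) : ℤ[X] :=
  (2 * (X ^ k - X ^ (k + 1) - 2 * X ^ (k + 2) - X ^ (k + 3) + X ^ (k + 4) -
      X ^ (2 * k + 5)) ^ (2 * k + 6) *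
    (((k + 3 : ℕ) : ℤ[X]) * X ^ 2 * ∑ i ∈ Finset.range (k + 3), (X ^ 2) ^ i +
      X ^ (k + 3) * (X - 2 * (X ^ 2 + 1))) *
    ((∑ i ∈ Finset.range (k + 3), X ^ i) ^ 2 - X ^ (k + 1) * (1 + X + X ^ 2))).comp (X ^ 2)

theorem eight_mul_tau_eq_aeval {k : ℕ} {a : ℂ} (ha : aeval a (Qp (2 * (k + 3))) = 0)
    (h1 : a ^ 2 ≠ 1) (h2 : a ^ 2 ≠ -1) :
    8 * tau (2 * (k + 3)) a = aeval a (eightTauPoly k) := by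
  rw [aeval_Qp_two_mul] at ha
  have hpow : a ^ (2 * (k + 3) + 4) = (a ^ 2) ^ (k + 5) := by ring
  have h4 : a ^ 4 = (a ^ 2) ^ 2 := by ring
  have h6 : a ^ 6 = (a ^ 2) ^ 3 := by ring
  have h8 : a ^ 8 = (a ^ 2) ^ 4 := by ring
  rw [tau, eightTauPoly, aeval_comp, hpow, h4, h6, h8]
  simp only [map_add, map_sub, map_mul, map_pow, aeval_X, map_one, map_ofNat, map_sum,
    map_natCast]
  generalize a ^ 2 = y at *
  have hy1 : y - 1 ≠ 0 := sub_ne_zero.2 h1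
  have hy2 : 1 + y ≠ 0 := fun h => h2 (by linear_combination h)
  have hS := geom_sum_mul y (k + 3)
  have hT := geom_sum_mul (y ^ 2) (k + 3)
  set S := ∑ i ∈ Finset.range (k + 3), y ^ i
  set T := ∑ i ∈ Finset.range (k + 3), (y ^ 2) ^ i
  set v := y ^ k - y ^ (k + 1) - 2 * y ^ (k + 2) - y ^ (k + 3) + y ^ (k + 4) -
    y ^ (2 * k + 5) with hv
  have hinv : v ^ (2 * k + 6) * y ^ (2 * k + 6) = 1 := by
    rw [← mul_pow, show v * y = 1 by rw [hv]; linear_combination -ha, one_pow]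
  have hk : (S ^ 2 - y ^ (k + 1) * (1 + y + y ^ 2)) * (y - 1) ^ 2 = -4 * y ^ (k + 3) := by
    linear_combination (S * (y - 1) + (y ^ (k + 3) - 1)) * hS + ha
  have hW : ((k + 3 : ℕ) * y ^ 2 * T + y ^ (k + 3) * (y - 2 * (y ^ 2 + 1))) * (y ^ 2 - 1) =
      y ^ (k + 3) * (2 - (k + 3 : ℕ) + ((k + 3 : ℕ) - 1) * y + 2 * (k + 3 : ℕ) * y ^ 2 +
        ((k + 3 : ℕ) + 1) * y ^ 3 - ((k + 3 : ℕ) + 2) * y ^ 4 + 2 * (k + 3 : ℕ) * y ^ (k + 5)) := by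
    linear_combination (k + 3 : ℕ) * y ^ 2 * hT - (k + 3 : ℕ) * y ^ 2 * ha
  set U := S ^ 2 - y ^ (k + 1) * (1 + y + y ^ 2)
  set W := (k + 3 : ℕ) * y ^ 2 * T + y ^ (k + 3) * (y - 2 * (y ^ 2 + 1))
  set M := 2 - ((k + 3 : ℕ) : ℂ) + ((k + 3 : ℕ) - 1) * y + 2 * (k + 3 : ℕ) * y ^ 2 +
        ((k + 3 : ℕ) + 1) * y ^ 3 - ((k + 3 : ℕ) + 2) * y ^ 4 + 2 * (k + 3 : ℕ) * y ^ (k + 5) with hM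
  have key : 2 * v ^ (2 * k + 6) * W * U * ((y - 1) ^ 3 * (1 + y)) = -8 * M := by
    linear_combination 2 * v ^ (2 * k + 6) * W * (y ^ 2 - 1) * hk -
      8 * v ^ (2 * k + 6) * y ^ (k + 3) * hW - 8 * M * hinv
  rw [← neg_div, ← mul_div_assoc, div_eq_iff (mul_ne_zero (mul_ne_zero two_ne_zero (pow_ne_zero 3 hy1)) hy2)]
  push_cast at key hM ⊢
  linear_combination -2 * key + 16 * hM

/-- for odd `m ≥ 3`, `p = 2m`, and `n ≥ 2`: no complex root of `Q_{2m}` lies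
in `{1, -1, √-1, -√-1}`, and `∑_a (8τ_{2m}(a))^n`, over the distinct complex roots of
`Q_{2m}`, is an integer. -/
theorem stmt18 (m : ℕ) (hm : 3 ≤ m) (hodd : Odd m) (n : ℕ) (hn : 2 ≤ n) :
    (∀ a : ℂ, Polynomial.aeval a (Qp (2 * m)) = 0 →
      a ≠ 1 ∧ a ≠ -1 ∧ a ≠ Complex.I ∧ a ≠ -Complex.I) ∧
    ∃ z : ℤ, ∑ a ∈ QpRoots (2 * m), (8 * tau (2 * m) a) ^ n = (z : ℂ) := by
  refine ⟨fun a ha => ?_, ?_⟩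
  · obtain ⟨h1, h2⟩ := sq_ne_of_aeval_Qp_eq_zero hm hodd ha
    refine ⟨?_, ?_, ?_, ?_⟩ <;> rintro rfl <;> simp at h1 h2
  · obtain ⟨k, rfl⟩ := Nat.exists_eq_add_of_le' hm
    obtain ⟨z, hz⟩ := exists_int_eq_sum_aeval_roots (monic_Qp (p := 2 * (k + 3)) (by omega))
      (eightTauPoly k ^ n)
    refine ⟨z, ?_⟩
    rw [← hz]
    refine Finset.sum_congr rfl fun a ha => ?_
    have hroot : aeval a (Qp (2 * (k + 3))) = 0 := by
      have h := (mem_roots'.1 (Multiset.mem_toFinset.1 ha)).2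
      rwa [IsRoot.def, eval_map] at h
    obtain ⟨h1, h2⟩ := sq_ne_of_aeval_Qp_eq_zero hm hodd hroot
    rw [eight_mul_tau_eq_aeval hroot h1 h2, map_pow]
end
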